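/- Let Ω ⊂ ℝ^d (d ≥ 2) be a bounded open set and let 1 < p < ∞. There exist positive constants C₁ and C₂ such that for every smooth compactly supported vector field u ∈ C_c^∞(Ω; ℝ^d), one has C₁ (‖u‖_{L^p(Ω)} + ‖∇u‖_{L^p(Ω)}) ≤ ‖u‖_{L^p(Ω)} + ‖𝒟(u)‖_{L^p(Ω)} ≤ C₂ (‖u‖_{L^p(Ω)} + ‖∇u‖_{L^p(Ω)}), where ∇u denotes the Jacobian matrix of u and 𝒟(u) = (∇u + (∇u)ᵀ)/2 is its symmetric part. (Since W_0^{1,p}(Ω; ℝ^d) is the completion of C_c^∞(Ω; ℝ^d) in the W^{1,p} norm, this is the norm-equivalence of Lemma 2.1 of the paper on a dense subspace.) -/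

import Mathlib

open MeasureTheory

section Heat

open Filter Topology Real
open scoped ContDiff

lemma exists_norm_le_closedBall {W W' : Type*} [NormedAddCommGroup W] [ProperSpace W]
    [NormedAddCommGroup W'] {g : W → W'}
    (hg : Continuous g) (R : ℝ) : ∃ M, 0 ≤ M ∧ ∀ w ∈ Metric.closedBall (0 : W) R, ‖g w‖ ≤ M := by
  obtain ⟨M, hM⟩ := (isCompact_closedBall (0 : W) R).exists_bound_of_continuousOn hg.continuousOn
  exact ⟨max M 0, le_max_right _ _, fun w hw => (hM w hw).trans (le_max_left _ _)⟩

variable {d : ℕ} {W : Type*} [NormedAddCommGroup W] [NormedSpace ℝ W]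

/-- The Gaussian weight on Euclidean space, of total mass one. -/
noncomputable def gaussWeight (z : EuclideanSpace ℝ (Fin d)) : ℝ := exp (-π * ‖z‖ ^ 2)

lemma gaussWeight_pos (z : EuclideanSpace ℝ (Fin d)) : 0 < gaussWeight z := exp_pos _

lemma gaussWeight_le_one (z : EuclideanSpace ℝ (Fin d)) : gaussWeight z ≤ 1 := by
  rw [gaussWeight, exp_le_one_iff]
  nlinarith [pi_pos, sq_nonneg ‖z‖]

lemma contDiff_gaussWeight : ContDiff ℝ ∞ (gaussWeight (d := d)) := by
  unfold gaussWeight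
  exact (contDiff_const.mul (contDiff_norm_sq ℝ)).exp

lemma continuous_gaussWeight : Continuous (gaussWeight (d := d)) :=
  contDiff_gaussWeight.continuous

lemma fderiv_gaussWeight_single (z : EuclideanSpace ℝ (Fin d)) (i : Fin d) :
    fderiv ℝ gaussWeight z (EuclideanSpace.single i 1) = -(2 * π) * (gaussWeight z * z i) := by
  have h : HasFDerivAt (gaussWeight (d := d)) (gaussWeight z • ((-π) • (2 • innerSL ℝ z))) z :=
    ((hasStrictFDerivAt_norm_sq z).hasFDerivAt.const_mul (-π)).exp
  rw [h.fderiv]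
  simp [EuclideanSpace.inner_single_right]
  ring

lemma integral_gaussWeight : ∫ z, gaussWeight (d := d) z = 1 := by
  simp only [gaussWeight]
  rw [GaussianFourier.integral_rexp_neg_mul_sq_norm pi_pos, div_self pi_pos.ne', one_rpow]

lemma integrable_pow_mul_gaussWeight (n : ℕ) :
    Integrable (fun z : EuclideanSpace ℝ (Fin d) => (1 + ‖z‖) ^ n * gaussWeight z) := by
  have h1 : Integrable (fun z : EuclideanSpace ℝ (Fin d) => exp (-1 * ‖z‖ ^ 2)) := by
    refine Integrable.of_integral_ne_zero ?_
    rw [GaussianFourier.integral_rexp_neg_mul_sq_norm one_pos]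
    positivity
  refine (h1.const_mul (n.factorial * exp 2)).mono'
    (by have := continuous_gaussWeight (d := d); fun_prop) (.of_forall fun z => ?_)
  have hz := norm_nonneg z
  rw [norm_of_nonneg (mul_nonneg (by positivity) (gaussWeight_pos z).le)]
  have h2 := pow_div_factorial_le_exp (1 + ‖z‖) (by positivity) n
  rw [div_le_iff₀ (by positivity)] at h2
  calc (1 + ‖z‖) ^ n * gaussWeight z ≤ exp (1 + ‖z‖) * n.factorial * gaussWeight z := by
        gcongr; exact (gaussWeight_pos z).le
    _ = n.factorial * exp (1 + ‖z‖ + -π * ‖z‖ ^ 2) := by rw [gaussWeight, exp_add (1 + ‖z‖)]; ring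
    _ ≤ n.factorial * exp (2 + -1 * ‖z‖ ^ 2) := by
        refine mul_le_mul_of_nonneg_left (exp_le_exp.2 ?_) (by positivity)
        nlinarith [pi_gt_three, sq_nonneg (‖z‖ - 1), sq_nonneg ‖z‖]
    _ = _ := by rw [exp_add]; ring

lemma integrable_gaussWeight : Integrable (gaussWeight (d := d)) := by
  simpa using integrable_pow_mul_gaussWeight (d := d) 0

/-- The heat extension of `f`, with the square root of time as parameter. -/
noncomputable def heat (f : EuclideanSpace ℝ (Fin d) → W) (s : ℝ)
    (x : EuclideanSpace ℝ (Fin d)) : W :=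
  ∫ z, gaussWeight z • f (x + s • z)

/-- The derivative of `f` in the `i`-th coordinate direction. -/
noncomputable def partialDeriv (i : Fin d) (f : EuclideanSpace ℝ (Fin d) → W) :
    EuclideanSpace ℝ (Fin d) → W :=
  fun x => fderiv ℝ f x (EuclideanSpace.single i 1)

/-- Smooth compactly supported functions. -/
structure IsTestFun (f : EuclideanSpace ℝ (Fin d) → W) : Prop where
  smooth : ContDiff ℝ ∞ f
  compact : HasCompactSupport f

namespace IsTestFun

variable {f : EuclideanSpace ℝ (Fin d) → W}

lemma continuous (hf : IsTestFun f) : Continuous f := hf.smooth.continuous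

lemma integrable (hf : IsTestFun f) : Integrable f :=
  hf.continuous.integrable_of_hasCompactSupport hf.compact

lemma hasFDerivAt (hf : IsTestFun f) (x : EuclideanSpace ℝ (Fin d)) :
    HasFDerivAt f (fderiv ℝ f x) x :=
  (hf.smooth.differentiable (by simp) x).hasFDerivAt

lemma fderiv (hf : IsTestFun f) : IsTestFun (fderiv ℝ f) :=
  ⟨hf.smooth.fderiv_right (by simp), hf.compact.fderiv ℝ⟩

lemma partialDeriv (hf : IsTestFun f) (i : Fin d) : IsTestFun (partialDeriv i f) :=
  ⟨hf.fderiv.smooth.clm_apply contDiff_const, hf.compact.fderiv_apply ℝ _⟩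

lemma clm_comp {W' : Type*} [NormedAddCommGroup W'] [NormedSpace ℝ W'] (hf : IsTestFun f)
    (L : W →L[ℝ] W') : IsTestFun (fun x => L (f x)) :=
  ⟨L.contDiff.comp hf.smooth, hf.compact.comp_left (g := L) (map_zero L)⟩

lemma prodMk {W' : Type*} [NormedAddCommGroup W'] [NormedSpace ℝ W']
    {g : EuclideanSpace ℝ (Fin d) → W'} (hf : IsTestFun f) (hg : IsTestFun g) :
    IsTestFun (fun x => (f x, g x)) := by
  refine ⟨hf.smooth.prodMk hg.smooth, ?_⟩
  refine HasCompactSupport.intro (hf.compact.isCompact.union hg.compact.isCompact) fun x hx => ?_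
  simp only [Set.mem_union, not_or] at hx
  simp [image_eq_zero_of_notMem_tsupport hx.1, image_eq_zero_of_notMem_tsupport hx.2]

lemma exists_bound (hf : IsTestFun f) : ∃ C, 0 ≤ C ∧ ∀ x, ‖f x‖ ≤ C := by
  obtain ⟨C, hC⟩ := hf.compact.exists_bound_of_continuous hf.continuous
  exact ⟨C, (norm_nonneg _).trans (hC 0), hC⟩

lemma exists_pow_bound (hf : IsTestFun f) (n : ℕ) :
    ∃ C, 0 ≤ C ∧ ∀ x, (1 + ‖x‖) ^ n * ‖f x‖ ≤ C := by
  have hc : Continuous fun x => (1 + ‖x‖) ^ n • f x := by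
    have := hf.continuous; fun_prop
  have hs : HasCompactSupport fun x => (1 + ‖x‖) ^ n • f x := hf.compact.smul_left
  obtain ⟨C, hC⟩ := hs.exists_bound_of_continuous hc
  refine ⟨C, (norm_nonneg _).trans (hC 0), fun x => (le_of_eq ?_).trans (hC x)⟩
  rw [norm_smul, norm_of_nonneg (by positivity)]

lemma integrable_heat_integrand (hf : IsTestFun f) (s : ℝ) (x : EuclideanSpace ℝ (Fin d)) :
    Integrable (fun z => gaussWeight z • f (x + s • z)) := by
  obtain ⟨C, -, hC⟩ := hf.exists_bound
  refine (integrable_gaussWeight.mul_const C).mono' ?_ (.of_forall fun z => ?_)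
  · have := hf.continuous
    have := continuous_gaussWeight (d := d)
    exact Continuous.aestronglyMeasurable (by fun_prop)
  · rw [norm_smul, norm_of_nonneg (gaussWeight_pos z).le]
    exact mul_le_mul_of_nonneg_left (hC _) (gaussWeight_pos z).le

lemma continuous_heat (hf : IsTestFun f) (s : ℝ) : Continuous (heat f s) := by
  obtain ⟨C, -, hC⟩ := hf.exists_bound
  refine continuous_of_dominated (bound := fun z => gaussWeight z * C)
    (fun x => (hf.integrable_heat_integrand s x).aestronglyMeasurable)
    (fun x => .of_forall fun z => ?_) (integrable_gaussWeight.mul_const C)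
    (.of_forall fun z => ?_)
  · rw [norm_smul, norm_of_nonneg (gaussWeight_pos z).le]
    exact mul_le_mul_of_nonneg_left (hC _) (gaussWeight_pos z).le
  · have := hf.continuous
    fun_prop

lemma exists_heat_decay (hf : IsTestFun f) (n : ℕ) (T : ℝ) :
    ∃ C, 0 ≤ C ∧ ∀ s, |s| ≤ T → ∀ x, (1 + ‖x‖) ^ n * ‖heat f s x‖ ≤ C := by
  obtain ⟨C, hC0, hC⟩ := hf.exists_pow_bound n
  refine ⟨∫ z : EuclideanSpace ℝ (Fin d), (1 + |T|) ^ n * C * ((1 + ‖z‖) ^ n * gaussWeight z),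
    integral_nonneg fun z => ?_, fun s hs x => ?_⟩
  · have := (gaussWeight_pos z).le
    positivity
  rw [← norm_of_nonneg (show 0 ≤ (1 + ‖x‖) ^ n by positivity), ← norm_smul, heat,
    ← integral_smul]
  refine norm_integral_le_of_norm_le ((integrable_pow_mul_gaussWeight n).const_mul _)
    (.of_forall fun z => ?_)
  rw [norm_smul, norm_smul, norm_of_nonneg (gaussWeight_pos z).le,
    norm_of_nonneg (show 0 ≤ (1 + ‖x‖) ^ n by positivity)]
  have h1 : 1 + ‖x‖ ≤ (1 + ‖x + s • z‖) * ((1 + |T|) * (1 + ‖z‖)) := by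
    have h2 : ‖x‖ ≤ ‖x + s • z‖ + |s| * ‖z‖ := by
      have := norm_sub_le (x + s • z) (s • z)
      rwa [add_sub_cancel_right, norm_smul, norm_eq_abs] at this
    have h3 : |s| * ‖z‖ ≤ |T| * ‖z‖ :=
      mul_le_mul_of_nonneg_right (hs.trans (le_abs_self T)) (norm_nonneg z)
    have h4 := norm_nonneg (x + s • z)
    have h5 := norm_nonneg z
    have h6 := abs_nonneg T
    nlinarith [mul_nonneg h4 h5, mul_nonneg h4 h6, mul_nonneg h4 (mul_nonneg h6 h5),
      mul_nonneg h6 h5]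
  have h7 := (gaussWeight_pos z).le
  calc (1 + ‖x‖) ^ n * (gaussWeight z * ‖f (x + s • z)‖)
      ≤ ((1 + ‖x + s • z‖) * ((1 + |T|) * (1 + ‖z‖))) ^ n * (gaussWeight z * ‖f (x + s • z)‖) := by
        gcongr
    _ = (1 + |T|) ^ n * ((1 + ‖x + s • z‖) ^ n * ‖f (x + s • z)‖)
          * ((1 + ‖z‖) ^ n * gaussWeight z) := by
        rw [mul_pow, mul_pow]; ring
    _ ≤ _ := by gcongr; exact hC _

lemma hasDerivAt_heat_affine (hf : IsTestFun f) (x v : EuclideanSpace ℝ (Fin d)) (s σ t : ℝ) :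
    HasDerivAt (fun t => heat f (s + t * σ) (x + t • v))
      (∫ z, gaussWeight z • _root_.fderiv ℝ f (x + t • v + (s + t * σ) • z) (v + σ • z)) t := by
  obtain ⟨C, hC0, hC⟩ := hf.fderiv.exists_bound
  have hc := hf.continuous
  have hc' := hf.fderiv.continuous
  have hg := continuous_gaussWeight (d := d)
  refine (hasDerivAt_integral_of_dominated_loc_of_deriv_le (s := Set.univ)
    (bound := fun z => (1 + ‖z‖) ^ 1 * gaussWeight z * (C * (‖v‖ + |σ|))) univ_mem
    (F := fun t z => gaussWeight z • f (x + t • v + (s + t * σ) • z))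
    (F' := fun t z => gaussWeight z • _root_.fderiv ℝ f (x + t • v + (s + t * σ) • z) (v + σ • z))
    (.of_forall fun t => (hf.integrable_heat_integrand _ _).aestronglyMeasurable)
    (hf.integrable_heat_integrand _ _) ?_ (.of_forall fun z t _ => ?_)
    ((integrable_pow_mul_gaussWeight 1).mul_const _) (.of_forall fun z t _ => ?_)).2
  · exact Continuous.aestronglyMeasurable (by fun_prop)
  · have h7 := (gaussWeight_pos z).le
    rw [norm_smul, norm_of_nonneg h7]
    have h1 : ‖v + σ • z‖ ≤ (1 + ‖z‖) * (‖v‖ + |σ|) := by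
      refine (norm_add_le _ _).trans ?_
      rw [norm_smul, norm_eq_abs]
      nlinarith [norm_nonneg v, norm_nonneg z, abs_nonneg σ,
        mul_nonneg (norm_nonneg z) (norm_nonneg v)]
    calc gaussWeight z * ‖_root_.fderiv ℝ f (x + t • v + (s + t * σ) • z) (v + σ • z)‖
        ≤ gaussWeight z * (C * ((1 + ‖z‖) * (‖v‖ + |σ|))) := by
          gcongr
          exact (ContinuousLinearMap.le_opNorm _ _).trans (by gcongr; exact hC _)
      _ = _ := by ring
  · have h1 : HasDerivAt (fun t : ℝ => x + t • v + (s + t * σ) • z) (v + σ • z) t := by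
      have h2 := ((hasDerivAt_id t).smul_const v).const_add x
      have h3 := (((hasDerivAt_id t).mul_const σ).const_add s).smul_const z
      rw [one_smul] at h2
      rw [one_mul] at h3
      exact h2.add h3
    exact ((hf.hasFDerivAt _).comp_hasDerivAt t h1).const_smul _

lemma hasLineDerivAt_heat (hf : IsTestFun f) (s : ℝ) (x : EuclideanSpace ℝ (Fin d)) (i : Fin d) :
    HasLineDerivAt ℝ (heat f s) (heat (_root_.partialDeriv i f) s x) x
      (EuclideanSpace.single i 1) := by
  have := hf.hasDerivAt_heat_affine x (EuclideanSpace.single i 1) s 0 0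
  simpa [HasLineDerivAt, heat, _root_.partialDeriv] using this

lemma integral_gaussWeight_coord_smul (hf : IsTestFun f) (s : ℝ) (x : EuclideanSpace ℝ (Fin d))
    (i : Fin d) :
    ∫ z, gaussWeight z • (z i • f (x + s • z))
      = (s / (2 * π)) • heat (_root_.partialDeriv i f) s x := by
  have hc := hf.continuous
  have hg := continuous_gaussWeight (d := d)
  have hd' : ∀ z, HasFDerivAt (fun z => f (x + s • z))
      (s • _root_.fderiv ℝ f (x + s • z)) z := fun z => by
    have h1 : HasFDerivAt (fun z : EuclideanSpace ℝ (Fin d) => x + s • z)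
        (s • ContinuousLinearMap.id ℝ _) z := ((hasFDerivAt_id z).const_smul s).const_add x
    refine ((hf.hasFDerivAt _).comp z h1).congr_fderiv ?_
    ext; simp
  have hd : ∀ z, _root_.fderiv ℝ (fun z => f (x + s • z)) z (EuclideanSpace.single i 1)
      = s • _root_.partialDeriv i f (x + s • z) := fun z => by
    rw [(hd' z).fderiv]; rfl
  obtain ⟨C, hC0, hC⟩ := hf.exists_bound
  have hint : Integrable (fun z => gaussWeight z • (z i • f (x + s • z))) := by
    refine ((integrable_pow_mul_gaussWeight 1).mul_const C).mono'
      (Continuous.aestronglyMeasurable (by fun_prop)) (.of_forall fun z => ?_)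
    have h7 := (gaussWeight_pos z).le
    rw [norm_smul, norm_smul, norm_of_nonneg h7]
    calc gaussWeight z * (‖z i‖ * ‖f (x + s • z)‖) ≤ gaussWeight z * ((1 + ‖z‖) * C) := by
          gcongr
          · linarith [PiLp.norm_apply_le z i]
          · exact hC _
      _ = _ := by ring
  have key := integral_smul_fderiv_eq_neg_fderiv_smul_of_integrable (μ := volume)
    (f := gaussWeight (d := d)) (g := fun z => f (x + s • z)) (v := EuclideanSpace.single i 1)
    ?_ ?_ (hf.integrable_heat_integrand s x)
    (fun z _ => contDiff_gaussWeight.differentiable (by simp) z)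
    (fun z _ => (hd' z).differentiableAt)
  · simp only [hd, fderiv_gaussWeight_single] at key
    have e1 : (fun z => gaussWeight z • s • _root_.partialDeriv i f (x + s • z))
        = fun z => s • (gaussWeight z • _root_.partialDeriv i f (x + s • z)) := by
      ext z; rw [smul_comm]
    have e2 : (fun z : EuclideanSpace ℝ (Fin d) => (-(2 * π) * (gaussWeight z * z i)) • f (x + s • z))
        = fun z => (-(2 * π)) • (gaussWeight z • (z i • f (x + s • z))) := by
      ext z; simp only [smul_smul]
    rw [e1, e2, integral_smul, integral_smul, neg_smul, neg_neg] at key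
    rw [heat, div_eq_inv_mul, ← smul_smul, key, smul_smul, inv_mul_cancel₀ (by positivity),
      one_smul]
  · simp only [fderiv_gaussWeight_single]
    refine (hint.smul (-(2 * π))).congr (.of_forall fun z => ?_)
    simp only [Pi.smul_apply, smul_smul]
  · simp only [hd]
    refine (((hf.partialDeriv i).integrable_heat_integrand s x).smul s).congr
      (.of_forall fun z => ?_)
    simp only [Pi.smul_apply]; rw [smul_comm]

lemma hasDerivAt_heat (hf : IsTestFun f) (s : ℝ) (x : EuclideanSpace ℝ (Fin d)) :
    HasDerivAt (fun s => heat f s x)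
      ((s / (2 * π)) • ∑ i, heat (_root_.partialDeriv i (_root_.partialDeriv i f)) s x) s := by
  have h := hf.hasDerivAt_heat_affine x 0 0 1 s
  simp only [zero_add, mul_one, smul_zero, add_zero, one_smul] at h
  refine h.congr_deriv ?_
  rw [Finset.smul_sum]
  simp_rw [← (hf.partialDeriv _).integral_gaussWeight_coord_smul s x]
  rw [← integral_finsetSum]
  · congr 1
    ext z
    rw [← Finset.smul_sum]
    congr 1
    conv_lhs => enter [2]; rw [← (EuclideanSpace.basisFun (Fin d) ℝ).sum_repr z]
    simp [_root_.partialDeriv]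
  · intro i _
    obtain ⟨C, hC0, hC⟩ := (hf.partialDeriv i).exists_bound
    have hc := (hf.partialDeriv i).continuous
    have hg := continuous_gaussWeight (d := d)
    refine ((integrable_pow_mul_gaussWeight 1).mul_const C).mono'
      (Continuous.aestronglyMeasurable (by fun_prop)) (.of_forall fun z => ?_)
    have h7 := (gaussWeight_pos z).le
    rw [norm_smul, norm_smul, norm_of_nonneg h7]
    calc gaussWeight z * (‖z i‖ * ‖_root_.partialDeriv i f (x + s • z)‖)
        ≤ gaussWeight z * ((1 + ‖z‖) * C) := by
          gcongr
          · linarith [PiLp.norm_apply_le z i]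
          · exact hC _
      _ = _ := by ring

lemma exists_heat_bound (hf : IsTestFun f) (T : ℝ) :
    ∃ C, 0 ≤ C ∧ ∀ s, |s| ≤ T → ∀ x, ‖heat f s x‖ ≤ C * (1 + ‖x‖) ^ (-((d : ℝ) + 1)) := by
  obtain ⟨C, hC0, hC⟩ := hf.exists_heat_decay (d + 1) T
  refine ⟨C, hC0, fun s hs x => ?_⟩
  have h1 : (1 + ‖x‖) ^ (-((d : ℝ) + 1)) = ((1 + ‖x‖) ^ (d + 1))⁻¹ := by
    rw [rpow_neg (by positivity)]; norm_cast
  rw [h1, ← div_eq_mul_inv, le_div_iff₀ (by positivity), mul_comm]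
  exact hC s hs x

lemma integrable_heat (hf : IsTestFun f) (s : ℝ) : Integrable (heat f s) := by
  obtain ⟨C, -, hC⟩ := hf.exists_heat_bound |s|
  exact ((integrable_one_add_norm (by simp)).const_mul C).mono'
    (hf.continuous_heat s).aestronglyMeasurable (.of_forall fun x => hC s le_rfl x)

lemma heat_clm_comp [CompleteSpace W] {W' : Type*} [NormedAddCommGroup W'] [NormedSpace ℝ W']
    [CompleteSpace W'] (hf : IsTestFun f) (L : W →L[ℝ] W') (s : ℝ)
    (x : EuclideanSpace ℝ (Fin d)) : heat (fun x => L (f x)) s x = L (heat f s x) := by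
  rw [heat, heat, ← L.integral_comp_comm (hf.integrable_heat_integrand s x)]
  simp

lemma partialDeriv_clm_comp {W' : Type*} [NormedAddCommGroup W'] [NormedSpace ℝ W']
    (hf : IsTestFun f) (L : W →L[ℝ] W') (i : Fin d) :
    _root_.partialDeriv i (fun x => L (f x)) = fun x => L (_root_.partialDeriv i f x) := by
  ext x
  have := (L.hasFDerivAt.comp x (hf.hasFDerivAt x)).fderiv
  simp only [_root_.partialDeriv]
  erw [this]
  rfl

lemma exists_heat_mem_closedBall (hf : IsTestFun f) (T : ℝ) :
    ∃ R, 0 ≤ R ∧ ∀ s, |s| ≤ T → ∀ x, heat f s x ∈ Metric.closedBall (0 : W) R := by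
  obtain ⟨R, hR0, hR⟩ := hf.exists_heat_decay 0 T
  exact ⟨R, hR0, fun s hs x => by simpa using hR s hs x⟩

variable [ProperSpace W] {B : W → ℝ}

lemma exists_energy_integrand_bound (hf : IsTestFun f) (hB : ContDiff ℝ 2 B) (T : ℝ) :
    ∃ C, 0 ≤ C ∧ ∀ s, |s| ≤ T → ∀ x,
      ‖B (heat f s x) - B 0‖ ≤ C * (1 + ‖x‖) ^ (-((d : ℝ) + 1)) := by
  obtain ⟨C, hC0, hC⟩ := hf.exists_heat_bound T
  obtain ⟨R, hR0, hR⟩ := hf.exists_heat_mem_closedBall T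
  obtain ⟨M, hM0, hM⟩ := exists_norm_le_closedBall (hB.continuous_fderiv (by simp)) R
  refine ⟨M * C, by positivity, fun s hs x => ?_⟩
  have := (convex_closedBall (0 : W) R).norm_image_sub_le_of_norm_fderiv_le
    (fun w _ => hB.differentiable (by simp) w) hM (Metric.mem_closedBall_self hR0) (hR s hs x)
  rw [sub_zero] at this
  exact this.trans (by rw [mul_assoc]; gcongr; exact hC s hs x)

lemma integrable_energy_integrand (hf : IsTestFun f) (hB : ContDiff ℝ 2 B) (s : ℝ) :
    Integrable (fun x => B (heat f s x) - B 0) := by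
  obtain ⟨C, -, hC⟩ := hf.exists_energy_integrand_bound hB |s|
  exact ((integrable_one_add_norm (by simp)).const_mul C).mono'
    ((hB.continuous.comp (hf.continuous_heat s)).sub continuous_const).aestronglyMeasurable
    (.of_forall fun x => hC s le_rfl x)

lemma integrable_clm_apply_heat {W' : Type*} [NormedAddCommGroup W'] [NormedSpace ℝ W']
    {W'' : Type*} [NormedAddCommGroup W''] [NormedSpace ℝ W'']
    {h : EuclideanSpace ℝ (Fin d) → W''}
    (hf : IsTestFun f) {A : W → W'' →L[ℝ] W'} (hA : Continuous A) (hh : IsTestFun h) (s : ℝ) :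
    Integrable (fun x => A (heat f s x) (heat h s x)) := by
  obtain ⟨R, hR0, hR⟩ := hf.exists_heat_mem_closedBall |s|
  obtain ⟨M, hM0, hM⟩ := exists_norm_le_closedBall hA R
  refine ((hh.integrable_heat s).norm.const_mul M).mono'
    ((hA.comp (hf.continuous_heat s)).clm_apply (hh.continuous_heat s)).aestronglyMeasurable
    (.of_forall fun x => (ContinuousLinearMap.le_opNorm _ _).trans ?_)
  gcongr
  exact hM _ (hR s le_rfl x)

lemma integrable_hessian_heat (hf : IsTestFun f) (hB : ContDiff ℝ 2 B) (s : ℝ) (i : Fin d) :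
    Integrable (fun x => _root_.fderiv ℝ (_root_.fderiv ℝ B) (heat f s x)
      (heat (_root_.partialDeriv i f) s x) (heat (_root_.partialDeriv i f) s x)) := by
  have hB1 : ContDiff ℝ 1 (_root_.fderiv ℝ B) := hB.fderiv_right (by norm_num)
  obtain ⟨R, hR0, hR⟩ := (hf.partialDeriv i).exists_heat_mem_closedBall |s|
  have h1 := hf.integrable_clm_apply_heat (hB1.continuous_fderiv (by simp)) (hf.partialDeriv i) s
  refine (h1.norm.mul_const R).mono' (((hB1.continuous_fderiv (by simp)).comp
    (hf.continuous_heat s)).clm_apply ((hf.partialDeriv i).continuous_heat s)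
    |>.clm_apply ((hf.partialDeriv i).continuous_heat s)).aestronglyMeasurable
    (.of_forall fun x => (ContinuousLinearMap.le_opNorm _ _).trans ?_)
  gcongr
  simpa using hR s le_rfl x

lemma integral_fderiv_heat_partialDeriv (hf : IsTestFun f) (hB : ContDiff ℝ 2 B) (s : ℝ)
    (i : Fin d) :
    ∫ x, _root_.fderiv ℝ B (heat f s x)
        (heat (_root_.partialDeriv i (_root_.partialDeriv i f)) s x)
      = -∫ x, _root_.fderiv ℝ (_root_.fderiv ℝ B) (heat f s x)
        (heat (_root_.partialDeriv i f) s x) (heat (_root_.partialDeriv i f) s x) := by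
  have hB1 : ContDiff ℝ 1 (_root_.fderiv ℝ B) := hB.fderiv_right (by norm_num)
  have hcB := hB.continuous_fderiv (by simp)
  refine integral_bilinear_hasLineDerivAt_right_eq_neg_left_of_integrable
    (B := ContinuousLinearMap.id ℝ (W →L[ℝ] ℝ)) (v := EuclideanSpace.single i 1)
    (f := fun x => _root_.fderiv ℝ B (heat f s x)) (g := heat (_root_.partialDeriv i f) s)
    (f' := fun x => _root_.fderiv ℝ (_root_.fderiv ℝ B) (heat f s x)
        (heat (_root_.partialDeriv i f) s x))
    (hf.integrable_hessian_heat hB s i)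
    (hf.integrable_clm_apply_heat hcB ((hf.partialDeriv i).partialDeriv i) s)
    (hf.integrable_clm_apply_heat hcB (hf.partialDeriv i) s) (fun x _ => ?_)
    (fun x _ => (hf.partialDeriv i).hasLineDerivAt_heat s x i)
  have h1 := (hB1.differentiable (by simp) (heat f s x)).hasFDerivAt
  have h2 := hf.hasLineDerivAt_heat s x i
  unfold HasLineDerivAt at h2 ⊢
  exact HasFDerivAt.comp_hasDerivAt_of_eq (0 : ℝ) h1 h2 (by simp)

/-- The derivative of an energy functional along the heat flow. -/
lemma hasDerivAt_energy (hf : IsTestFun f) (hB : ContDiff ℝ 2 B) (s : ℝ) :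
    HasDerivAt (fun s => ∫ x, (B (heat f s x) - B 0))
      (-(s / (2 * π)) * ∫ x, ∑ i, _root_.fderiv ℝ (_root_.fderiv ℝ B) (heat f s x)
        (heat (_root_.partialDeriv i f) s x) (heat (_root_.partialDeriv i f) s x)) s := by
  have hcB := hB.continuous_fderiv (by simp)
  have htest := fun i : Fin d => (hf.partialDeriv i).partialDeriv i
  obtain ⟨R, hR0, hR⟩ := hf.exists_heat_mem_closedBall (|s| + 1)
  obtain ⟨M, hM0, hM⟩ := exists_norm_le_closedBall hcB R
  choose C hC0 hC using fun i => (htest i).exists_heat_bound (|s| + 1)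
  have key := (hasDerivAt_integral_of_dominated_loc_of_deriv_le (μ := volume)
    (s := Metric.ball s 1)
    (F := fun s x => B (heat f s x) - B 0)
    (F' := fun s x => _root_.fderiv ℝ B (heat f s x) ((s / (2 * π)) • ∑ i, heat
      (_root_.partialDeriv i (_root_.partialDeriv i f)) s x))
    (bound := fun x => M * ((|s| + 1) / (2 * π) * ∑ i, C i) * (1 + ‖x‖) ^ (-((d : ℝ) + 1)))
    (Metric.ball_mem_nhds s one_pos)
    (.of_forall fun t => (hf.integrable_energy_integrand hB t).aestronglyMeasurable)
    (hf.integrable_energy_integrand hB s) ?_ (.of_forall fun x t ht => ?_)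
    ((integrable_one_add_norm (by simp)).const_mul _) (.of_forall fun x t ht => ?_)).2
  · refine key.congr_deriv ?_
    simp only [map_smul, map_sum, smul_eq_mul]
    rw [integral_const_mul, integral_finsetSum _
      (fun i _ => hf.integrable_clm_apply_heat hcB (htest i) s),
      integral_finsetSum _ (fun i _ => hf.integrable_hessian_heat hB s i)]
    simp only [hf.integral_fderiv_heat_partialDeriv hB, Finset.sum_neg_distrib]
    ring
  · refine ((hcB.comp (hf.continuous_heat s)).clm_apply ?_).aestronglyMeasurable
    exact (continuous_finsetSum _ fun i _ => (htest i).continuous_heat s).const_smul _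
  · have hts : |t| ≤ |s| + 1 := by
      rw [Metric.mem_ball, dist_eq] at ht
      have := abs_sub_abs_le_abs_sub t s
      linarith
    refine (ContinuousLinearMap.le_opNorm _ _).trans ?_
    rw [mul_assoc]
    gcongr
    · exact hM _ (hR t hts x)
    · rw [norm_smul, mul_assoc, norm_eq_abs, abs_div, abs_of_pos (show 0 < 2 * π by positivity),
        Finset.sum_mul]
      gcongr
      exact (norm_sum_le _ _).trans (Finset.sum_le_sum fun i _ => hC i t hts x)
  · exact ((hB.differentiable (by simp) _).hasFDerivAt.comp_hasDerivAt t
      (hf.hasDerivAt_heat t x)).sub_const _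

end IsTestFun

lemma heat_zero [CompleteSpace W] (f : EuclideanSpace ℝ (Fin d) → W) : heat f 0 = f := by
  ext x
  simp [heat, integral_smul_const, integral_gaussWeight]

namespace IsTestFun

lemma norm_heat_le {f : EuclideanSpace ℝ (Fin d) → W} (hf : IsTestFun f) {s : ℝ} (hs : 0 < s)
    (x : EuclideanSpace ℝ (Fin d)) : ‖heat f s x‖ ≤ (s ^ d)⁻¹ * ∫ y, ‖f y‖ := by
  have h1 : ∫ z, ‖f (x + s • z)‖ = (s ^ d)⁻¹ * ∫ y, ‖f y‖ := by
    rw [Measure.integral_comp_smul volume (fun y => ‖f (x + y)‖) s,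
      integral_add_left_eq_self (fun y => ‖f y‖) x]
    simp [abs_of_pos hs]
  have hint : Integrable fun z => ‖f (x + s • z)‖ :=
    ((hf.integrable.comp_add_left x).comp_smul hs.ne').norm
  rw [← h1]
  refine norm_integral_le_of_norm_le hint (.of_forall fun z => ?_)
  rw [norm_smul, norm_of_nonneg (gaussWeight_pos z).le]
  exact mul_le_of_le_one_left (norm_nonneg _) (gaussWeight_le_one z)

lemma integral_norm_heat_le {f : EuclideanSpace ℝ (Fin d) → W} (hf : IsTestFun f) (s : ℝ) :
    ∫ x, ‖heat f s x‖ ≤ ∫ x, ‖f x‖ := by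
  have hc := hf.continuous
  have hg := continuous_gaussWeight (d := d)
  have hz : ∀ z : EuclideanSpace ℝ (Fin d),
      ∫ x, gaussWeight z * ‖f (x + s • z)‖ = gaussWeight z * ∫ x, ‖f x‖ := fun z => by
    rw [integral_const_mul, integral_add_right_eq_self (fun y => ‖f y‖) (s • z)]
  have hprod : Integrable (fun q : EuclideanSpace ℝ (Fin d) × EuclideanSpace ℝ (Fin d) =>
      gaussWeight q.2 * ‖f (q.1 + s • q.2)‖) (volume.prod volume) := by
    rw [integrable_prod_iff' (Continuous.aestronglyMeasurable (by fun_prop))]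
    refine ⟨.of_forall fun z =>
      ((hf.integrable.comp_add_right (s • z)).norm).const_mul (gaussWeight z), ?_⟩
    simp only [norm_mul, norm_norm, norm_of_nonneg (gaussWeight_pos _).le, hz]
    exact integrable_gaussWeight.mul_const _
  calc ∫ x, ‖heat f s x‖ ≤ ∫ x, ∫ z, gaussWeight z * ‖f (x + s • z)‖ := by
        refine integral_mono (hf.integrable_heat s).norm hprod.integral_prod_left fun x => ?_
        refine (norm_integral_le_integral_norm _).trans_eq (integral_congr_ae (.of_forall fun z => ?_))
        simp only [norm_smul, norm_of_nonneg (gaussWeight_pos z).le]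
    _ = ∫ z, ∫ x, gaussWeight z * ‖f (x + s • z)‖ := integral_integral_swap hprod
    _ = ∫ x, ‖f x‖ := by
        simp only [hz]
        rw [integral_mul_const, integral_gaussWeight, one_mul]

lemma tendsto_integral_heat_mul_heat [NeZero d] {w g : EuclideanSpace ℝ (Fin d) → ℝ}
    (hw : IsTestFun w) (hg : IsTestFun g) :
    Tendsto (fun s => ∫ x, heat w s x * heat g s x) atTop (𝓝 0) := by
  have hlim : Tendsto (fun s : ℝ => (s ^ d)⁻¹ * (∫ y, ‖w y‖) * ∫ y, ‖g y‖) atTop (𝓝 0) := by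
    have := (tendsto_pow_atTop (α := ℝ) (NeZero.ne d)).inv_tendsto_atTop
    simpa using (this.mul_const (∫ y, ‖w y‖)).mul_const (∫ y, ‖g y‖)
  refine squeeze_zero_norm' ?_ hlim
  filter_upwards [eventually_gt_atTop 0] with s hs
  calc ‖∫ x, heat w s x * heat g s x‖
      ≤ ∫ x, (s ^ d)⁻¹ * (∫ y, ‖w y‖) * ‖heat g s x‖ := by
        refine norm_integral_le_of_norm_le ((hg.integrable_heat s).norm.const_mul _)
          (.of_forall fun x => ?_)
        rw [norm_mul]
        gcongr
        exact hw.norm_heat_le hs x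
    _ ≤ _ := by
        rw [integral_const_mul]
        exact mul_le_mul_of_nonneg_left (hg.integral_norm_heat_le s) (by positivity)

end IsTestFun

lemma fderiv_fderiv_mul (z v : ℝ × ℝ) :
    fderiv ℝ (fderiv ℝ fun q : ℝ × ℝ => q.1 * q.2) z v v = 2 * (v.1 * v.2) := by
  have h : (fderiv ℝ fun q : ℝ × ℝ => q.1 * q.2) =
      ((ContinuousLinearMap.fst ℝ ℝ ℝ).smulRight (ContinuousLinearMap.snd ℝ ℝ ℝ)
        + (ContinuousLinearMap.snd ℝ ℝ ℝ).smulRight (ContinuousLinearMap.fst ℝ ℝ ℝ) :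
          ℝ × ℝ →L[ℝ] (ℝ × ℝ →L[ℝ] ℝ)) := by
    ext1 z
    exact ((hasFDerivAt_fst (p := z)).mul (hasFDerivAt_snd (p := z))).fderiv
  rw [h, ContinuousLinearMap.fderiv]
  simp
  ring

/-- A convex function of two variables whose Hessian dominates `τ a² + τ⁻¹ b²`. -/
structure IsBellman (B : ℝ × ℝ → ℝ) : Prop where
  contDiff : ContDiff ℝ 2 B
  zero_le : ∀ z, B 0 ≤ B z
  hessian : ∀ z, ∃ τ > 0, ∀ v : ℝ × ℝ,
    τ * v.1 ^ 2 + τ⁻¹ * v.2 ^ 2 ≤ fderiv ℝ (fderiv ℝ B) z v v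

lemma IsBellman.mul_le_sum_hessian {B : ℝ × ℝ → ℝ} (hB : IsBellman B) (z : ℝ × ℝ)
    (v : Fin d → ℝ × ℝ) (l i : Fin d) :
    2 * |(v l).1 * (v i).2| ≤ ∑ m, fderiv ℝ (fderiv ℝ B) z (v m) (v m) := by
  obtain ⟨τ, hτ, h⟩ := hB.hessian z
  have h1 : (v l).1 ^ 2 ≤ ∑ m, (v m).1 ^ 2 :=
    Finset.single_le_sum (f := fun m => (v m).1 ^ 2) (fun m _ => sq_nonneg _) (Finset.mem_univ l)
  have h2 : (v i).2 ^ 2 ≤ ∑ m, (v m).2 ^ 2 :=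
    Finset.single_le_sum (f := fun m => (v m).2 ^ 2) (fun m _ => sq_nonneg _) (Finset.mem_univ i)
  calc 2 * |(v l).1 * (v i).2| ≤ τ * (v l).1 ^ 2 + τ⁻¹ * (v i).2 ^ 2 := by
        rw [abs_mul, ← sq_abs (v l).1, ← sq_abs (v i).2]
        have h3 : τ * |(v l).1| ^ 2 + τ⁻¹ * |(v i).2| ^ 2 - 2 * (|(v l).1| * |(v i).2|)
            = τ⁻¹ * (τ * |(v l).1| - |(v i).2|) ^ 2 := by field_simp; ring
        have h4 : 0 ≤ τ⁻¹ * (τ * |(v l).1| - |(v i).2|) ^ 2 := by positivity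
        linarith
    _ ≤ τ * ∑ m, (v m).1 ^ 2 + τ⁻¹ * ∑ m, (v m).2 ^ 2 := by gcongr
    _ = ∑ m, (τ * (v m).1 ^ 2 + τ⁻¹ * (v m).2 ^ 2) := by
        rw [Finset.mul_sum, Finset.mul_sum, Finset.sum_add_distrib]
    _ ≤ _ := Finset.sum_le_sum fun m _ => h (v m)

/-- The bilinear embedding: if the gradient of `w` is a combination of derivatives of the `e a b`,
as is the case for `w = ∂ⱼ uₖ` and `e` the symmetric gradient of `u`, then the pairing of `w` with
`g` is controlled by the energies of the pairs `(e a b, g)`. -/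
theorem integral_mul_le_of_isBellman [NeZero d] {B : ℝ × ℝ → ℝ} (hB : IsBellman B)
    {w g : EuclideanSpace ℝ (Fin d) → ℝ} {e : Fin d → Fin d → EuclideanSpace ℝ (Fin d) → ℝ}
    (hw : IsTestFun w) (hg : IsTestFun g) (he : ∀ a b, IsTestFun (e a b)) (j k : Fin d)
    (hwe : ∀ i x, partialDeriv i w x = partialDeriv i (e j k) x + partialDeriv j (e i k) x
      - partialDeriv k (e i j) x) :
    ∫ x, w x * g x ≤ 3 * d * ∑ a, ∑ b, ∫ x, (B (e a b x, g x) - B 0) := by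
  have hwg := hw.prodMk hg
  have heg := fun a b => (he a b).prodMk hg
  set Q : ℝ × ℝ → ℝ := fun q => q.1 * q.2 with hQ
  have hQ2 : ContDiff ℝ 2 Q := contDiff_fst.mul contDiff_snd
  have fst_eq : ∀ {f : EuclideanSpace ℝ (Fin d) → ℝ × ℝ}, IsTestFun f → ∀ s x,
      (heat f s x).1 = heat (fun x => (f x).1) s x := fun hf s x =>
    (hf.heat_clm_comp (ContinuousLinearMap.fst ℝ ℝ ℝ) s x).symm
  have snd_eq : ∀ {f : EuclideanSpace ℝ (Fin d) → ℝ × ℝ}, IsTestFun f → ∀ s x,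
      (heat f s x).2 = heat (fun x => (f x).2) s x := fun hf s x =>
    (hf.heat_clm_comp (ContinuousLinearMap.snd ℝ ℝ ℝ) s x).symm
  have dfst : ∀ {f : EuclideanSpace ℝ (Fin d) → ℝ}, IsTestFun f → ∀ i s x,
      (heat (partialDeriv i fun x => (f x, g x)) s x).1 = heat (partialDeriv i f) s x :=
    fun hf i s x => by
      rw [fst_eq ((hf.prodMk hg).partialDeriv i)]
      congr 1
      exact ((hf.prodMk hg).partialDeriv_clm_comp (ContinuousLinearMap.fst ℝ ℝ ℝ) i).symm
  have dsnd : ∀ {f : EuclideanSpace ℝ (Fin d) → ℝ}, IsTestFun f → ∀ i s x,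
      (heat (partialDeriv i fun x => (f x, g x)) s x).2 = heat (partialDeriv i g) s x :=
    fun hf i s x => by
      rw [snd_eq ((hf.prodMk hg).partialDeriv i)]
      congr 1
      exact ((hf.prodMk hg).partialDeriv_clm_comp (ContinuousLinearMap.snd ℝ ℝ ℝ) i).symm
  set H : Fin d → Fin d → ℝ → EuclideanSpace ℝ (Fin d) → ℝ := fun a b s x =>
    ∑ i, fderiv ℝ (fderiv ℝ B) (heat (fun x => (e a b x, g x)) s x)
      (heat (partialDeriv i fun x => (e a b x, g x)) s x)
      (heat (partialDeriv i fun x => (e a b x, g x)) s x) with hH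
  have hHint : ∀ a b s, Integrable (H a b s) := fun a b s =>
    integrable_finsetSum _ fun i _ => (heg a b).integrable_hessian_heat hB.contDiff s i
  have hmul : ∀ a b l i s x,
      2 * |heat (partialDeriv l (e a b)) s x * heat (partialDeriv i g) s x| ≤ H a b s x :=
    fun a b l i s x => by
      have := hB.mul_le_sum_hessian (heat (fun x => (e a b x, g x)) s x)
        (fun i => heat (partialDeriv i fun x => (e a b x, g x)) s x) l i
      rwa [dfst (he a b), dsnd (he a b)] at this
  have hH0 : ∀ a b s x, 0 ≤ H a b s x := fun a b s x =>
    le_trans (by positivity) (hmul a b j j s x)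
  have hHsum : ∀ a b s x, H a b s x ≤ ∑ a, ∑ b, H a b s x := fun a b s x =>
    (Finset.single_le_sum (f := fun b => H a b s x) (fun b _ => hH0 a b s x)
      (Finset.mem_univ b)).trans
    (Finset.single_le_sum (f := fun a => ∑ b, H a b s x)
      (fun a _ => Finset.sum_nonneg fun b _ => hH0 a b s x) (Finset.mem_univ a))
  have hheat : ∀ i s x, heat (partialDeriv i w) s x = heat (partialDeriv i (e j k)) s x
      + heat (partialDeriv j (e i k)) s x - heat (partialDeriv k (e i j)) s x := by
    intro i s x
    have i1 := ((he j k).partialDeriv i).integrable_heat_integrand s x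
    have i2 := ((he i k).partialDeriv j).integrable_heat_integrand s x
    have i3 := ((he i j).partialDeriv k).integrable_heat_integrand s x
    rw [heat, heat, heat, heat, ← integral_add i1 i2]
    erw [← integral_sub (i1.add i2) i3]
    congr 1
    ext z
    simp only [hwe, smul_eq_mul, Pi.add_apply]
    ring
  have hdom : ∀ s x, ∑ i, 2 * (heat (partialDeriv i w) s x * heat (partialDeriv i g) s x)
      ≤ 3 * d * ∑ a, ∑ b, H a b s x := by
    intro s x
    have : ∀ i ∈ (Finset.univ : Finset (Fin d)),
        2 * (heat (partialDeriv i w) s x * heat (partialDeriv i g) s x)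
          ≤ 3 * ∑ a, ∑ b, H a b s x := fun i _ => by
      have h1 := (hmul j k i i s x).trans (hHsum j k s x)
      have h2 := (hmul i k j i s x).trans (hHsum i k s x)
      have h3 := (hmul i j k i s x).trans (hHsum i j s x)
      rw [hheat, sub_mul, add_mul]
      linarith [le_abs_self (heat (partialDeriv i (e j k)) s x * heat (partialDeriv i g) s x),
        le_abs_self (heat (partialDeriv j (e i k)) s x * heat (partialDeriv i g) s x),
        neg_abs_le (heat (partialDeriv k (e i j)) s x * heat (partialDeriv i g) s x)]
    refine (Finset.sum_le_sum this).trans_eq ?_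
    simp
    ring
  have hP : ∀ s, HasDerivAt (fun s => ∫ x, heat w s x * heat g s x)
      (-(s / (2 * π)) * ∫ x, ∑ i, 2 * (heat (partialDeriv i w) s x * heat (partialDeriv i g) s x))
      s := fun s => by
    have := hwg.hasDerivAt_energy hQ2 s
    simp only [hQ, fderiv_fderiv_mul, dfst hw, dsnd hw, fst_eq hwg, snd_eq hwg] at this
    simpa using this
  have hPint : ∀ s, Integrable
      fun x => ∑ i, 2 * (heat (partialDeriv i w) s x * heat (partialDeriv i g) s x) := fun s => by
    refine integrable_finsetSum _ fun i _ => ?_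
    have := hwg.integrable_hessian_heat hQ2 s i
    simpa only [hQ, fderiv_fderiv_mul, dfst hw, dsnd hw] using this
  set Ψ : ℝ → ℝ := fun s => 3 * d * (∑ a, ∑ b, ∫ x, (B (heat (fun x => (e a b x, g x)) s x) - B 0))
    - ∫ x, heat w s x * heat g s x with hΨ
  have hΨd : ∀ s, HasDerivAt Ψ (-(s / (2 * π)) * ∫ x, (3 * d * (∑ a, ∑ b, H a b s x)
      - ∑ i, 2 * (heat (partialDeriv i w) s x * heat (partialDeriv i g) s x))) s := fun s => by
    have h1 : HasDerivAt
        (fun s => ∑ a, ∑ b, ∫ x, (B (heat (fun x => (e a b x, g x)) s x) - B 0))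
        (∑ a, ∑ b, (-(s / (2 * π)) * ∫ x, H a b s x)) s :=
      HasDerivAt.fun_sum fun a _ => HasDerivAt.fun_sum fun b _ =>
        (heg a b).hasDerivAt_energy hB.contDiff s
    refine ((h1.const_mul (3 * d : ℝ)).sub (hP s)).congr_deriv ?_
    have hi1 : ∀ a, Integrable fun x => ∑ b, H a b s x := fun a =>
      integrable_finsetSum _ fun b _ => hHint a b s
    rw [integral_sub ((integrable_finsetSum _ fun a _ => hi1 a).const_mul _) (hPint s),
      integral_const_mul, integral_finsetSum _ fun a _ => hi1 a]
    simp only [integral_finsetSum _ fun b _ => hHint _ b s, ← Finset.mul_sum]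
    ring
  have hanti : AntitoneOn Ψ (Set.Ici 0) := by
    refine antitoneOn_of_deriv_nonpos (convex_Ici 0)
      (fun s _ => (hΨd s).continuousAt.continuousWithinAt)
      (fun s _ => (hΨd s).differentiableAt.differentiableWithinAt) fun s hs => ?_
    rw [interior_Ici, Set.mem_Ioi] at hs
    rw [(hΨd s).deriv]
    refine mul_nonpos_of_nonpos_of_nonneg (by rw [neg_nonpos]; positivity)
      (integral_nonneg fun x => ?_)
    simpa using hdom s x
  have hlower : ∀ s, 0 ≤ s → -(∫ x, heat w s x * heat g s x) ≤ Ψ 0 := fun s hs => by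
    refine le_trans ?_ (hanti Set.self_mem_Ici hs hs)
    have : 0 ≤ 3 * d * ∑ a, ∑ b, ∫ x, (B (heat (fun x => (e a b x, g x)) s x) - B 0) := by
      refine mul_nonneg (by positivity) (Finset.sum_nonneg fun a _ => Finset.sum_nonneg fun b _ =>
        integral_nonneg fun x => ?_)
      simpa using hB.zero_le _
    simp only [hΨ]
    linarith
  have h0 : (0 : ℝ) ≤ Ψ 0 := by
    have := (hw.tendsto_integral_heat_mul_heat hg).neg
    rw [neg_zero] at this
    exact le_of_tendsto this ((eventually_ge_atTop 0).mono hlower)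
  simpa [hΨ, heat_zero] using h0

lemma fderiv_fderiv_eq_of_hasDerivAt_line {W : Type*} [NormedAddCommGroup W] [NormedSpace ℝ W]
    {B : W → ℝ} (hB : ContDiff ℝ 2 B) {z v : W} {h' : ℝ → ℝ} {c : ℝ}
    (h1 : ∀ t, HasDerivAt (fun t : ℝ => B (z + t • v)) (h' t) t) (h2 : HasDerivAt h' c 0) :
    fderiv ℝ (fderiv ℝ B) z v v = c := by
  have hline : ∀ t : ℝ, HasDerivAt (fun t : ℝ => z + t • v) v t := fun t => by
    simpa using ((hasDerivAt_id t).smul_const v).const_add z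
  have hB1 : ContDiff ℝ 1 (fderiv ℝ B) := hB.fderiv_right (by norm_num)
  have e1 : h' = fun t => fderiv ℝ B (z + t • v) v := by
    ext t
    exact (h1 t).unique
      ((hB.differentiable (by simp) _).hasFDerivAt.comp_hasDerivAt t (hline t))
  have h3 : HasDerivAt (fun t : ℝ => fderiv ℝ B (z + t • v)) (fderiv ℝ (fderiv ℝ B) z v) 0 :=
    HasFDerivAt.comp_hasDerivAt_of_eq (0 : ℝ)
      (hB1.differentiable (by simp) z).hasFDerivAt (hline 0) (by simp)
  have h4 : HasDerivAt h' (fderiv ℝ (fderiv ℝ B) z v v) 0 := by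
    rw [e1]
    simpa using h3.clm_apply (hasDerivAt_const (0 : ℝ) v)
  exact h4.unique h2

/-- A regularised Bellman function of Nazarov and Treil. -/
noncomputable def bellman (p q A ε : ℝ) (z : ℝ × ℝ) : ℝ :=
  A * (ε + z.2 ^ 2) ^ (q / 2)
    + (ε + z.1 ^ 2) * ((ε + z.1 ^ 2) ^ (p / 2) + (ε + z.2 ^ 2) ^ (q / 2)) ^ (1 - 2 / p)

lemma contDiff_bellman (p q A : ℝ) {ε : ℝ} (hε : 0 < ε) : ContDiff ℝ 2 (bellman p q A ε) := by
  have hX : ContDiff ℝ 2 fun z : ℝ × ℝ => ε + z.1 ^ 2 := contDiff_const.add (contDiff_fst.pow 2)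
  have hY : ContDiff ℝ 2 fun z : ℝ × ℝ => ε + z.2 ^ 2 := contDiff_const.add (contDiff_snd.pow 2)
  have hU := hX.rpow_const_of_ne (p := p / 2) fun z => by positivity
  have hV := hY.rpow_const_of_ne (p := q / 2) fun z => by positivity
  exact (contDiff_const.mul hV).add
    (hX.mul ((hU.add hV).rpow_const_of_ne fun z => by positivity))

lemma bellman_bracket_lower {p α ζ a x r w : ℝ} (hp : 0 ≤ p) (hα0 : 0 ≤ α) (hα1 : α ≤ 1)
    (hx : 0 < x) (hζ : ζ ^ 2 ≤ x) (hr0 : 0 ≤ r) (hr1 : r ≤ 1) :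
    a ^ 2 - 5 * (x * w ^ 2) ≤ 2 * a ^ 2 + 4 * α * p * (a * ζ) ^ 2 * (r - r ^ 2 / 2) / x
      + 4 * (α * (1 - r)) * (a * ζ) * w - α * (1 - α) * (x * w ^ 2) := by
  have h1 : 0 ≤ 4 * α * p * (a * ζ) ^ 2 * (r - r ^ 2 / 2) / x := by
    have : 0 ≤ r - r ^ 2 / 2 := by nlinarith
    positivity
  have h2 : α * (1 - α) * (x * w ^ 2) ≤ x * w ^ 2 :=
    mul_le_of_le_one_left (by positivity) (mul_le_one₀ hα1 (by linarith) (by linarith))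
  have hκ0 : 0 ≤ α * (1 - r) := mul_nonneg hα0 (by linarith)
  have hκ1 : α * (1 - r) ≤ 1 := mul_le_one₀ hα1 (by linarith) (by linarith)
  generalize α * (1 - r) = κ at *
  have h3 : ζ ^ 2 * w ^ 2 ≤ x * w ^ 2 := by gcongr
  have h4 : κ ^ 2 * (ζ ^ 2 * w ^ 2) ≤ ζ ^ 2 * w ^ 2 :=
    mul_le_of_le_one_left (by positivity) (pow_le_one₀ hκ0 hκ1)
  have h5 : (a + 2 * κ * ζ * w) ^ 2
      = a ^ 2 + 4 * κ * (a * ζ) * w + 4 * (κ ^ 2 * (ζ ^ 2 * w ^ 2)) := by ring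
  have h6 := sq_nonneg (a + 2 * κ * ζ * w)
  linarith

lemma bellman_hessian_eq {p α m a x r w s P R : ℝ} (hp : p * (α - 1) = -2) (hx : x ≠ 0)
    (hs : s ≠ 0) :
    2 * a ^ 2 * P + 2 * (2 * m) * (p * m * (r * s / x) + w * s) * α * (P / s)
        + x * (R * α * (P / s) + (p * m * (r * s / x) + w * s) ^ 2 * α * (α - 1) * (P / s ^ 2))
      = P * (2 * a ^ 2 + 4 * α * p * m ^ 2 * (r - r ^ 2 / 2) / x
          + 4 * (α * (1 - r)) * m * w - α * (1 - α) * (x * w ^ 2))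
        + x * (R * α * (P / s)) := by
  have e1 : p * m * (r * s / x) + w * s = (p * m * r / x + w) * s := by field_simp
  have e2 : ∀ K : ℝ, K * s * α * (P / s) = K * α * P := fun K => by field_simp
  have e3 : ∀ K : ℝ, (K * s) ^ 2 * α * (α - 1) * (P / s ^ 2) = K ^ 2 * α * (α - 1) * P :=
    fun K => by field_simp
  rw [e1, e3, ← mul_assoc (2 * (2 * m)), e2, mul_add x]
  generalize x * (R * α * (P / s)) = T
  field_simp
  linear_combination (2 * α * P * (p * m ^ 2 * r ^ 2 + 2 * m * r * w * x)) * hp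

lemma bellman_hessian_algebra {p q α ζ η a b x y u v P : ℝ} (hp : 2 ≤ p) (hq1 : 1 < q)
    (hq2 : q ≤ 2) (hα : α = 1 - 2 / p) (hx : 0 < x) (hy : 0 < y) (hζ : ζ ^ 2 ≤ x) (hη : η ^ 2 ≤ y)
    (hu : 0 < u) (hv : 0 < v) (hPx : P * x ≤ u + v) (hPy : y / v ≤ P) :
    y / v * a ^ 2 + v / y * b ^ 2 ≤
      (5 * q ^ 2 + 1) / (q * (q - 1)) * (q * b ^ 2 * (v / y) + q * (q - 2) * η ^ 2 * b ^ 2 * (v / y ^ 2))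
      + (2 * a ^ 2 * P + 2 * (2 * a * ζ) * (p * a * ζ * (u / x) + q * b * η * (v / y))
          * α * (P / (u + v))
        + x * ((p * a ^ 2 * (u / x) + p * (p - 2) * ζ ^ 2 * a ^ 2 * (u / x ^ 2)
              + (q * b ^ 2 * (v / y) + q * (q - 2) * η ^ 2 * b ^ 2 * (v / y ^ 2)))
            * α * (P / (u + v))
          + (p * a * ζ * (u / x) + q * b * η * (v / y)) ^ 2 * α * (α - 1) * (P / (u + v) ^ 2))) := by
  have hp0 : 0 < p := by linarith
  have hα0 : 0 ≤ α := by
    rw [hα, sub_nonneg, div_le_one hp0]; exact hp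
  have hα1 : α ≤ 1 := by
    rw [hα]; have : 0 ≤ 2 / p := by positivity
    linarith
  have hαp : (1 - α) * p = 2 := by rw [hα]; field_simp; ring
  have hP : 0 < P := lt_of_lt_of_le (by positivity) hPy
  set s := u + v with hs
  have hs0 : 0 < s := by positivity
  set V2 := q * b ^ 2 * (v / y) + q * (q - 2) * η ^ 2 * b ^ 2 * (v / y ^ 2) with hV2
  have hV2' : q * (q - 1) * (b ^ 2 * (v / y)) ≤ V2 := by
    have h1 : η ^ 2 * (v / y ^ 2) ≤ v / y := by
      rw [show v / y = y * (v / y ^ 2) by field_simp]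
      gcongr
    have h2 : 0 ≤ q * (2 - q) * b ^ 2 := by
      have : 0 ≤ 2 - q := by linarith
      positivity
    nlinarith [mul_le_mul_of_nonneg_left h1 h2]
  have hqq : 0 < q * (q - 1) := mul_pos (by linarith) (by linarith)
  have hV20 : 0 ≤ V2 := le_trans (by positivity) hV2'
  set U2 := p * a ^ 2 * (u / x) + p * (p - 2) * ζ ^ 2 * a ^ 2 * (u / x ^ 2) with hU2
  have hU20 : 0 ≤ U2 := by
    have : 0 ≤ p - 2 := by linarith
    positivity
  -- normalised quantities
  set r := u / s with hr
  have hr0 : 0 ≤ r := by positivity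
  have hr1 : r ≤ 1 := by rw [hr, div_le_one hs0]; linarith
  set w := q * b * η * (v / y) / s with hw
  have hw' : q * b * η * (v / y) = w * s := by rw [hw]; field_simp
  have hu' : u = r * s := by rw [hr]; field_simp
  have hbr := bellman_bracket_lower (a := a) (w := w) hp0.le hα0 hα1 hx hζ hr0 hr1
  have hPw : P * (x * w ^ 2) ≤ q ^ 2 * (b ^ 2 * (v / y)) := by
    have h1 : P * x * v ≤ s ^ 2 := by
      calc P * x * v ≤ s * v := by gcongr
        _ ≤ s * s := by gcongr; linarith
        _ = s ^ 2 := by ring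
    calc P * (x * w ^ 2) = q ^ 2 * (b ^ 2 * (v / y)) * ((P * x * v / s ^ 2) * (η ^ 2 / y)) := by
          rw [hw]; field_simp
      _ ≤ q ^ 2 * (b ^ 2 * (v / y)) * (1 * 1) := by
          gcongr
          · rw [div_le_one (by positivity)]; exact h1
          · rw [div_le_one hy]; exact hη
      _ = _ := by ring
  have hp' : p * (α - 1) = -2 := by linarith
  rw [hw', hu', mul_assoc p a ζ, mul_assoc 2 a ζ, bellman_hessian_eq hp' hx.ne' hs0.ne']
  have h5 : 0 ≤ x * ((U2 + V2) * α * (P / s)) := by positivity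
  have h6 := mul_le_mul_of_nonneg_left hbr hP.le
  have h7 : (5 * q ^ 2 + 1) * (b ^ 2 * (v / y)) ≤ (5 * q ^ 2 + 1) / (q * (q - 1)) * V2 := by
    rw [div_mul_eq_mul_div, le_div_iff₀ hqq]
    nlinarith [mul_le_mul_of_nonneg_left hV2' (show 0 ≤ 5 * q ^ 2 + 1 by positivity)]
  have h8 : y / v * a ^ 2 ≤ P * a ^ 2 := by gcongr
  have h9 := mul_le_mul_of_nonneg_left hPw (show (0 : ℝ) ≤ 5 by norm_num)
  have h10 : v / y * b ^ 2 = b ^ 2 * (v / y) := mul_comm _ _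
  have h11 : P * (a ^ 2 - 5 * (x * w ^ 2)) = P * a ^ 2 - 5 * (P * (x * w ^ 2)) := by ring
  linarith

lemma hasDerivAt_add_sq_rpow {ε : ℝ} (hε : 0 < ε) (ζ a r t : ℝ) :
    HasDerivAt (fun t : ℝ => (ε + (ζ + t * a) ^ 2) ^ r)
      (2 * a * r * (ζ + t * a) * (ε + (ζ + t * a) ^ 2) ^ (r - 1)) t := by
  have h1 : HasDerivAt (fun t : ℝ => ε + (ζ + t * a) ^ 2) (2 * (ζ + t * a) * a) t := by
    simpa using ((((hasDerivAt_id t).mul_const a).const_add ζ).pow 2).const_add ε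
  convert h1.rpow_const (p := r) (Or.inl (by positivity)) using 1
  ring

lemma hasDerivAt_deriv_add_sq_rpow {ε : ℝ} (hε : 0 < ε) (ζ a r : ℝ) :
    HasDerivAt (fun t : ℝ => 2 * a * r * (ζ + t * a) * (ε + (ζ + t * a) ^ 2) ^ (r - 1))
      (2 * r * a ^ 2 * ((ε + ζ ^ 2) ^ r / (ε + ζ ^ 2))
        + 2 * r * (2 * r - 2) * ζ ^ 2 * a ^ 2 * ((ε + ζ ^ 2) ^ r / (ε + ζ ^ 2) ^ 2)) 0 := by
  have hx : 0 < ε + ζ ^ 2 := by positivity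
  have h1 : HasDerivAt (fun t : ℝ => 2 * a * r * (ζ + t * a)) (2 * a * r * a) 0 := by
    simpa using (((hasDerivAt_id (0 : ℝ)).mul_const a).const_add ζ).const_mul (2 * a * r)
  refine (h1.mul (hasDerivAt_add_sq_rpow hε ζ a (r - 1) 0)).congr_deriv ?_
  have e1 : (ε + ζ ^ 2) ^ (r - 1) = (ε + ζ ^ 2) ^ r / (ε + ζ ^ 2) := rpow_sub_one hx.ne' r
  have e2 : (ε + ζ ^ 2) ^ (r - 1 - 1) = (ε + ζ ^ 2) ^ r / (ε + ζ ^ 2) ^ 2 := by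
    rw [rpow_sub_one hx.ne', e1]; field_simp
  simp only [zero_mul, add_zero, e1, e2]
  ring

lemma hasDerivAt_mul_rpow {X X' S S' : ℝ → ℝ} {t : ℝ} (α : ℝ) (hX : HasDerivAt X (X' t) t)
    (hS : HasDerivAt S (S' t) t) (h0 : 0 < S t) :
    HasDerivAt (fun t => X t * S t ^ α) (X' t * S t ^ α + X t * (S' t * α * S t ^ (α - 1))) t :=
  hX.mul (hS.rpow_const (Or.inl h0.ne'))

lemma hasDerivAt_deriv_mul_rpow {X X' S S' : ℝ → ℝ} {t x'' s'' : ℝ} (α : ℝ)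
    (hX : HasDerivAt X (X' t) t) (hS : HasDerivAt S (S' t) t) (hX' : HasDerivAt X' x'' t)
    (hS' : HasDerivAt S' s'' t) (h0 : 0 < S t) :
    HasDerivAt (fun t => X' t * S t ^ α + X t * (S' t * α * S t ^ (α - 1)))
      (x'' * S t ^ α + 2 * X' t * S' t * α * (S t ^ α / S t)
        + X t * (s'' * α * (S t ^ α / S t) + S' t ^ 2 * α * (α - 1) * (S t ^ α / S t ^ 2))) t := by
  have e1 : S t ^ (α - 1) = S t ^ α / S t := rpow_sub_one h0.ne' α
  have e2 : S t ^ (α - 1 - 1) = S t ^ α / S t ^ 2 := by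
    rw [rpow_sub_one h0.ne', e1]; field_simp
  refine ((hX'.mul (hS.rpow_const (p := α) (Or.inl h0.ne'))).add
    (hX.mul ((hS'.mul_const α).mul
      (hS.rpow_const (p := α - 1) (Or.inl h0.ne'))))).congr_deriv ?_
  simp only [Pi.mul_apply, e1, e2]
  ring

lemma hessian_bellman (p q A : ℝ) {ε : ℝ} (hε : 0 < ε) (z v : ℝ × ℝ) {x y u w s P : ℝ}
    (hx : x = ε + z.1 ^ 2) (hy : y = ε + z.2 ^ 2) (hu : u = x ^ (p / 2)) (hw : w = y ^ (q / 2))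
    (hs : s = u + w) (hP : P = s ^ (1 - 2 / p)) :
    fderiv ℝ (fderiv ℝ (bellman p q A ε)) z v v =
      A * (q * v.2 ^ 2 * (w / y) + q * (q - 2) * z.2 ^ 2 * v.2 ^ 2 * (w / y ^ 2))
      + (2 * v.1 ^ 2 * P + 2 * (2 * v.1 * z.1)
            * (p * v.1 * z.1 * (u / x) + q * v.2 * z.2 * (w / y)) * (1 - 2 / p) * (P / s)
        + x * ((p * v.1 ^ 2 * (u / x) + p * (p - 2) * z.1 ^ 2 * v.1 ^ 2 * (u / x ^ 2)
              + (q * v.2 ^ 2 * (w / y) + q * (q - 2) * z.2 ^ 2 * v.2 ^ 2 * (w / y ^ 2)))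
            * (1 - 2 / p) * (P / s)
          + (p * v.1 * z.1 * (u / x) + q * v.2 * z.2 * (w / y)) ^ 2
            * (1 - 2 / p) * (1 - 2 / p - 1) * (P / s ^ 2))) := by
  obtain ⟨ζ, η⟩ := z
  obtain ⟨a, b⟩ := v
  have hx0 : 0 < x := by rw [hx]; positivity
  have hy0 : 0 < y := by rw [hy]; positivity
  have hX : ∀ t, HasDerivAt (fun t : ℝ => ε + (ζ + t * a) ^ 2) (2 * a * (ζ + t * a)) t := by
    intro t
    have h1 : HasDerivAt (fun t : ℝ => ε + (ζ + t * a) ^ 2) (2 * (ζ + t * a) * a) t := by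
      simpa using ((((hasDerivAt_id t).mul_const a).const_add ζ).pow 2).const_add ε
    exact h1.congr_deriv (by ring)
  have hX' : HasDerivAt (fun t : ℝ => 2 * a * (ζ + t * a)) (2 * a * a) 0 := by
    simpa using (((hasDerivAt_id (0 : ℝ)).mul_const a).const_add ζ).const_mul (2 * a)
  obtain ⟨U, hU⟩ : ∃ U : ℝ → ℝ, U = fun t => (ε + (ζ + t * a) ^ 2) ^ (p / 2) := ⟨_, rfl⟩
  obtain ⟨U', hU'⟩ : ∃ U' : ℝ → ℝ, U' = fun t =>
    2 * a * (p / 2) * (ζ + t * a) * (ε + (ζ + t * a) ^ 2) ^ (p / 2 - 1) := ⟨_, rfl⟩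
  obtain ⟨V, hV⟩ : ∃ V : ℝ → ℝ, V = fun t => (ε + (η + t * b) ^ 2) ^ (q / 2) := ⟨_, rfl⟩
  obtain ⟨V', hV'⟩ : ∃ V' : ℝ → ℝ, V' = fun t =>
    2 * b * (q / 2) * (η + t * b) * (ε + (η + t * b) ^ 2) ^ (q / 2 - 1) := ⟨_, rfl⟩
  have dU : ∀ t, HasDerivAt U (U' t) t := fun t => by
    rw [hU, hU']; exact hasDerivAt_add_sq_rpow hε ζ a (p / 2) t
  have dV : ∀ t, HasDerivAt V (V' t) t := fun t => by
    rw [hV, hV']; exact hasDerivAt_add_sq_rpow hε η b (q / 2) t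
  have dU' := hasDerivAt_deriv_add_sq_rpow hε ζ a (p / 2)
  have dV' := hasDerivAt_deriv_add_sq_rpow hε η b (q / 2)
  rw [← hU'] at dU'
  rw [← hV'] at dV'
  have hS0 : ∀ t : ℝ, 0 < U t + V t := fun t => by simp only [hU, hV]; positivity
  have hline : ∀ t : ℝ, bellman p q A ε ((ζ, η) + t • (a, b))
      = A * V t + (ε + (ζ + t * a) ^ 2) * (U t + V t) ^ (1 - 2 / p) := fun t => by
    simp [bellman, hU, hV]
  have e1 : (ε + ζ ^ 2) ^ (p / 2 - 1) = u / x := by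
    rw [← hx, rpow_sub_one hx0.ne', hu]
  have e2 : (ε + η ^ 2) ^ (q / 2 - 1) = w / y := by
    rw [← hy, rpow_sub_one hy0.ne', hw]
  have v1 : U 0 = u := by simp [hU, hu, hx]
  have v2 : V 0 = w := by simp [hV, hw, hy]
  have v3 : U' 0 = p * a * ζ * (u / x) := by
    simp only [hU', zero_mul, add_zero, e1]; ring
  have v4 : V' 0 = q * b * η * (w / y) := by
    simp only [hV', zero_mul, add_zero, e2]; ring
  have d1 : ∀ t, HasDerivAt (fun t : ℝ => bellman p q A ε ((ζ, η) + t • (a, b))) _ t := fun t => by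
    simp only [hline]
    exact ((dV t).const_mul A).add (hasDerivAt_mul_rpow (X' := fun t => 2 * a * (ζ + t * a))
      (S := fun t => U t + V t) (S' := fun t => U' t + V' t) (1 - 2 / p) (hX t)
      ((dU t).add (dV t)) (hS0 t))
  have d2 := (dV'.const_mul A).add (hasDerivAt_deriv_mul_rpow (X' := fun t => 2 * a * (ζ + t * a))
      (S := fun t => U t + V t) (S' := fun t => U' t + V' t) (1 - 2 / p) (hX 0)
      ((dU 0).add (dV 0)) hX' (dU'.add dV') (hS0 0))
  rw [fderiv_fderiv_eq_of_hasDerivAt_line (contDiff_bellman p q A hε) d1 d2]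
  simp only [v1, v2, v3, v4, zero_mul, add_zero]
  simp only [← hx, ← hy, ← hu, ← hw, ← hs, ← hP]
  ring

lemma isBellman_bellman {p q ε : ℝ} (hpq : p.HolderConjugate q) (hp : 2 ≤ p) (hε : 0 < ε) :
    IsBellman (bellman p q ((5 * q ^ 2 + 1) / (q * (q - 1))) ε) := by
  have hp0 := hpq.pos
  have hq1 := hpq.symm.lt
  have hq0 := hpq.symm.pos
  have hα0 : 0 ≤ 1 - 2 / p := by
    rw [sub_nonneg, div_le_one hp0]; exact hp
  have hA : 0 ≤ (5 * q ^ 2 + 1) / (q * (q - 1)) := by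
    have : 0 < q - 1 := by linarith
    positivity
  have hinv := hpq.inv_add_inv_eq_one
  have hq2 : q ≤ 2 := by
    have h1 : p⁻¹ ≤ 2⁻¹ := by gcongr
    have h2 : (2 : ℝ)⁻¹ ≤ q⁻¹ := by linarith
    exact (inv_le_inv₀ (by norm_num) hq0).1 h2
  refine ⟨contDiff_bellman _ _ _ hε, fun z => ?_, fun z => ?_⟩
  · simp only [bellman, Prod.fst_zero, Prod.snd_zero]
    have h1 : (0 : ℝ) ^ 2 ≤ z.1 ^ 2 := by simpa using sq_nonneg z.1
    have h2 : (0 : ℝ) ^ 2 ≤ z.2 ^ 2 := by simpa using sq_nonneg z.2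
    have h3 : (ε + 0 ^ 2) ^ (p / 2) ≤ (ε + z.1 ^ 2) ^ (p / 2) :=
      rpow_le_rpow (by positivity) (by linarith) (by positivity)
    have h4 : (ε + 0 ^ 2) ^ (q / 2) ≤ (ε + z.2 ^ 2) ^ (q / 2) :=
      rpow_le_rpow (by positivity) (by linarith) (by positivity)
    exact add_le_add (mul_le_mul_of_nonneg_left h4 hA)
      (mul_le_mul (by linarith) (rpow_le_rpow (by positivity) (by linarith) hα0)
        (by positivity) (by positivity))
  · set x := ε + z.1 ^ 2 with hx
    set y := ε + z.2 ^ 2 with hy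
    set u := x ^ (p / 2) with hu
    set w := y ^ (q / 2) with hw
    have hx0 : 0 < x := by positivity
    have hy0 : 0 < y := by positivity
    have hu0 : 0 < u := by positivity
    have hw0 : 0 < w := by positivity
    have hPx : (u + w) ^ (1 - 2 / p) * x ≤ u + w := by
      have h1 : x = u ^ (2 / p) := by
        rw [hu, ← rpow_mul hx0.le, show p / 2 * (2 / p) = 1 by field_simp, rpow_one]
      calc (u + w) ^ (1 - 2 / p) * x ≤ (u + w) ^ (1 - 2 / p) * (u + w) ^ (2 / p) := by
            rw [h1]; gcongr; linarith
        _ = u + w := by rw [← rpow_add (by positivity)]; simp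
    have hPy : y / w ≤ (u + w) ^ (1 - 2 / p) := by
      calc y / w = w ^ (1 - 2 / p) := by
            rw [hw, ← rpow_mul hy0.le, div_eq_iff (by positivity), ← rpow_add hy0]
            have : q / 2 * (1 - 2 / p) + q / 2 = 1 := by
              have := hpq.mul_eq_add
              field_simp
              nlinarith
            rw [this, rpow_one]
        _ ≤ _ := by gcongr; linarith
    refine ⟨y / w, by positivity, fun v => ?_⟩
    rw [hessian_bellman p q _ hε z v hx hy hu hw rfl rfl, inv_div]
    exact bellman_hessian_algebra hp hq1 hq2 rfl hx0 hy0 (by linarith) (by linarith) hu0 hw0 hPx hPy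

lemma IsBellman.comp_swap {B : ℝ × ℝ → ℝ} (hB : IsBellman B) : IsBellman (B ∘ Prod.swap) := by
  have hB2 : ContDiff ℝ 2 (B ∘ Prod.swap) := hB.contDiff.comp (contDiff_snd.prodMk contDiff_fst)
  have hB1 : ContDiff ℝ 1 (fderiv ℝ B) := hB.contDiff.fderiv_right (by norm_num)
  refine ⟨hB2, fun z => hB.zero_le z.swap, fun z => ?_⟩
  obtain ⟨τ, hτ, h⟩ := hB.hessian z.swap
  refine ⟨τ⁻¹, inv_pos.2 hτ, fun v => ?_⟩
  have hline : ∀ t : ℝ, HasDerivAt (fun t : ℝ => z.swap + t • v.swap) v.swap t := fun t => by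
    simpa using ((hasDerivAt_id t).smul_const v.swap).const_add z.swap
  have h1 : ∀ t : ℝ, HasDerivAt (fun t : ℝ => (B ∘ Prod.swap) (z + t • v))
      (fderiv ℝ B (z.swap + t • v.swap) v.swap) t := fun t =>
    (hB.contDiff.differentiable (by simp) _).hasFDerivAt.comp_hasDerivAt t (hline t)
  have h3 : HasDerivAt (fun t : ℝ => fderiv ℝ B (z.swap + t • v.swap))
      (fderiv ℝ (fderiv ℝ B) z.swap v.swap) 0 :=
    HasFDerivAt.comp_hasDerivAt_of_eq (0 : ℝ)
      (hB1.differentiable (by simp) z.swap).hasFDerivAt (hline 0) (by simp)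
  have h2 : HasDerivAt (fun t : ℝ => fderiv ℝ B (z.swap + t • v.swap) v.swap)
      (fderiv ℝ (fderiv ℝ B) z.swap v.swap v.swap) 0 := by
    simpa using h3.clm_apply (hasDerivAt_const (0 : ℝ) v.swap)
  rw [fderiv_fderiv_eq_of_hasDerivAt_line hB2 h1 h2, inv_inv, add_comm]
  exact h v.swap

lemma add_sq_rpow_le {p δ : ℝ} (hp : 1 ≤ p) (hδ : 0 < δ) (hδ1 : δ ≤ 1) (ζ : ℝ) :
    (δ ^ 2 + ζ ^ 2) ^ (p / 2) ≤ 2 ^ (p / 2) * (|ζ| ^ p + δ) := by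
  have hp0 : 0 < p := by linarith
  have hδp : δ ^ p ≤ δ := by
    simpa using rpow_le_rpow_of_exponent_ge hδ hδ1 hp
  have key : ∀ m : ℝ, 0 ≤ m → (m ^ 2) ^ (p / 2) = m ^ p := fun m hm => by
    rw [← rpow_natCast_mul hm]; congr 1; push_cast; ring
  have h1 : (δ ^ 2 + ζ ^ 2) ≤ 2 * (max δ |ζ|) ^ 2 := by
    have h1 : δ ^ 2 ≤ (max δ |ζ|) ^ 2 := by gcongr; exact le_max_left _ _
    have h2 : |ζ| ^ 2 ≤ (max δ |ζ|) ^ 2 := by gcongr; exact le_max_right _ _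
    rw [sq_abs] at h2
    linarith
  calc (δ ^ 2 + ζ ^ 2) ^ (p / 2) ≤ (2 * (max δ |ζ|) ^ 2) ^ (p / 2) := by gcongr
    _ = 2 ^ (p / 2) * (max δ |ζ|) ^ p := by
        rw [mul_rpow (by norm_num) (by positivity), key _ (by positivity)]
    _ ≤ 2 ^ (p / 2) * (|ζ| ^ p + δ) := by
        gcongr
        rcases max_cases δ |ζ| with ⟨h, -⟩ | ⟨h, -⟩ <;> rw [h]
        · have : 0 ≤ |ζ| ^ p := by positivity
          linarith
        · linarith

lemma exists_isBellman_of_two_le {p q : ℝ} (hpq : p.HolderConjugate q) (hp : 2 ≤ p) :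
    ∃ C, 0 ≤ C ∧ ∀ δ, 0 < δ → δ ≤ 1 → ∃ B, IsBellman B ∧
      ∀ z, B z - B 0 ≤ C * (|z.1| ^ p + |z.2| ^ q + δ) := by
  have hp0 := hpq.pos
  have hq1 := hpq.symm.lt
  have hq0 := hpq.symm.pos
  set A := (5 * q ^ 2 + 1) / (q * (q - 1)) with hA'
  have hA : 0 ≤ A := by
    have : 0 < q - 1 := by linarith
    positivity
  have hα0 : 0 ≤ 1 - 2 / p := by
    rw [sub_nonneg, div_le_one hp0]; exact hp
  refine ⟨(A + 1) * (2 * (2 ^ (p / 2) + 2 ^ (q / 2))), by positivity, fun δ hδ hδ1 =>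
    ⟨bellman p q A (δ ^ 2), isBellman_bellman hpq hp (by positivity), fun z => ?_⟩⟩
  have h0 : 0 ≤ bellman p q A (δ ^ 2) 0 := by
    simp only [bellman, Prod.fst_zero, Prod.snd_zero]
    positivity
  have hu := add_sq_rpow_le (by linarith : 1 ≤ p) hδ hδ1 z.1
  have hv := add_sq_rpow_le hq1.le hδ hδ1 z.2
  have hx : δ ^ 2 + z.1 ^ 2 = ((δ ^ 2 + z.1 ^ 2) ^ (p / 2)) ^ (2 / p) := by
    rw [← rpow_mul (by positivity), show p / 2 * (2 / p) = 1 by field_simp, rpow_one]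
  have hPx : (δ ^ 2 + z.1 ^ 2) * ((δ ^ 2 + z.1 ^ 2) ^ (p / 2) + (δ ^ 2 + z.2 ^ 2) ^ (q / 2))
        ^ (1 - 2 / p) ≤ (δ ^ 2 + z.1 ^ 2) ^ (p / 2) + (δ ^ 2 + z.2 ^ 2) ^ (q / 2) := by
    have hu0 : 0 < (δ ^ 2 + z.1 ^ 2) ^ (p / 2) := by positivity
    have hv0 : 0 < (δ ^ 2 + z.2 ^ 2) ^ (q / 2) := by positivity
    nth_rw 1 [hx]
    generalize (δ ^ 2 + z.1 ^ 2) ^ (p / 2) = u at *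
    generalize (δ ^ 2 + z.2 ^ 2) ^ (q / 2) = v at *
    calc u ^ (2 / p) * (u + v) ^ (1 - 2 / p) ≤ (u + v) ^ (2 / p) * (u + v) ^ (1 - 2 / p) := by
          gcongr; linarith
      _ = u + v := by rw [← rpow_add (by positivity)]; simp
  have h1 : bellman p q A (δ ^ 2) z
      ≤ (A + 1) * ((δ ^ 2 + z.1 ^ 2) ^ (p / 2) + (δ ^ 2 + z.2 ^ 2) ^ (q / 2)) := by
    have hu0 : 0 ≤ A * (δ ^ 2 + z.1 ^ 2) ^ (p / 2) := by positivity
    unfold bellman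
    linarith
  have h2 : (δ ^ 2 + z.1 ^ 2) ^ (p / 2) + (δ ^ 2 + z.2 ^ 2) ^ (q / 2)
      ≤ 2 * (2 ^ (p / 2) + 2 ^ (q / 2)) * (|z.1| ^ p + |z.2| ^ q + δ) := by
    have hζ : 0 ≤ |z.1| ^ p := by positivity
    have hη : 0 ≤ |z.2| ^ q := by positivity
    have k1 : (0 : ℝ) ≤ 2 ^ (p / 2) := by positivity
    have k2 : (0 : ℝ) ≤ 2 ^ (q / 2) := by positivity
    have h3 : (2 : ℝ) ^ (p / 2) * (|z.1| ^ p + δ) ≤ 2 ^ (p / 2) * (|z.1| ^ p + |z.2| ^ q + δ) := by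
      gcongr; linarith
    have h4 : (2 : ℝ) ^ (q / 2) * (|z.2| ^ q + δ) ≤ 2 ^ (q / 2) * (|z.1| ^ p + |z.2| ^ q + δ) := by
      gcongr; linarith
    have h5 : (0 : ℝ) ≤ (2 ^ (p / 2) + 2 ^ (q / 2)) * (|z.1| ^ p + |z.2| ^ q + δ) := by positivity
    linarith
  calc _ ≤ _ := sub_le_self _ h0
    _ ≤ _ := h1
    _ ≤ _ := mul_le_mul_of_nonneg_left h2 (by positivity)
    _ = _ := by ring

lemma exists_isBellman {p q : ℝ} (hpq : p.HolderConjugate q) :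
    ∃ C, 0 ≤ C ∧ ∀ δ, 0 < δ → δ ≤ 1 → ∃ B, IsBellman B ∧
      ∀ z, B z - B 0 ≤ C * (|z.1| ^ p + |z.2| ^ q + δ) := by
  rcases le_total 2 p with hp | hp
  · exact exists_isBellman_of_two_le hpq hp
  · have hq : 2 ≤ q := by
      have h1 := hpq.inv_add_inv_eq_one
      have h2 : (2 : ℝ)⁻¹ ≤ p⁻¹ := by
        have := hpq.pos
        gcongr
      have h3 : q⁻¹ ≤ 2⁻¹ := by linarith
      exact (inv_le_inv₀ hpq.symm.pos (by norm_num)).1 h3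
    obtain ⟨C, hC, h⟩ := exists_isBellman_of_two_le hpq.symm hq
    refine ⟨C, hC, fun δ hδ hδ1 => ?_⟩
    obtain ⟨B, hB, hle⟩ := h δ hδ hδ1
    refine ⟨B ∘ Prod.swap, hB.comp_swap, fun z => ?_⟩
    rw [add_comm (|z.1| ^ p)]
    exact hle z.swap

lemma IsTestFun.rpow_abs_eq_zero {f : EuclideanSpace ℝ (Fin d) → ℝ} {p : ℝ} (hp : 0 < p)
    {x : EuclideanSpace ℝ (Fin d)} (hx : x ∉ tsupport f) : |f x| ^ p = 0 := by
  rw [image_eq_zero_of_notMem_tsupport hx, abs_zero, zero_rpow hp.ne']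

lemma integral_bellman_le {B : ℝ × ℝ → ℝ} (hB : Continuous B) {p q C δ : ℝ} (hp : 0 < p)
    (hq : 0 < q) (hle : ∀ z, B z - B 0 ≤ C * (|z.1| ^ p + |z.2| ^ q + δ))
    {e g : EuclideanSpace ℝ (Fin d) → ℝ} (he : IsTestFun e) (hg : IsTestFun g) :
    ∫ x, (B (e x, g x) - B 0) ≤ C * ((∫ x, |e x| ^ p) + (∫ x, |g x| ^ q)
      + δ * volume.real (tsupport e ∪ tsupport g)) := by
  set K := tsupport e ∪ tsupport g with hK
  have hKc : IsCompact K := he.compact.isCompact.union hg.compact.isCompact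
  have hKm : volume K ≠ ⊤ := hKc.measure_lt_top.ne
  have c1 : Continuous fun x => |e x| ^ p := he.continuous.abs.rpow_const fun _ => Or.inr hp.le
  have c2 : Continuous fun x => |g x| ^ q := hg.continuous.abs.rpow_const fun _ => Or.inr hq.le
  have c3 : Continuous fun x => B (e x, g x) - B 0 :=
    (hB.comp (he.continuous.prodMk hg.continuous)).sub continuous_const
  rw [← setIntegral_eq_integral_of_forall_compl_eq_zero (s := K)
      (f := fun x => B (e x, g x) - B 0) fun x hx => ?_,
    ← setIntegral_eq_integral_of_forall_compl_eq_zero (s := K) (f := fun x => |e x| ^ p)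
      fun x hx => IsTestFun.rpow_abs_eq_zero hp fun h => hx (Or.inl h),
    ← setIntegral_eq_integral_of_forall_compl_eq_zero (s := K) (f := fun x => |g x| ^ q)
      fun x hx => IsTestFun.rpow_abs_eq_zero hq fun h => hx (Or.inr h)]
  · have i1 : IntegrableOn (fun x => |e x| ^ p) K := c1.continuousOn.integrableOn_compact hKc
    have i2 : IntegrableOn (fun x => |g x| ^ q) K := c2.continuousOn.integrableOn_compact hKc
    have i12 : IntegrableOn (fun x => |e x| ^ p + |g x| ^ q) K := i1.add i2
    have i3 : IntegrableOn (fun _ => δ) K volume := integrableOn_const hKm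
    calc ∫ x in K, (B (e x, g x) - B 0) ≤ ∫ x in K, C * (|e x| ^ p + |g x| ^ q + δ) :=
          integral_mono (c3.continuousOn.integrableOn_compact hKc)
            ((i12.add i3).const_mul C) fun x => hle _
      _ = _ := by
          rw [integral_const_mul, integral_add i12 i3, integral_add i1 i2,
            setIntegral_const, smul_eq_mul, mul_comm δ]
  · have h1 : e x = 0 := image_eq_zero_of_notMem_tsupport fun h => hx (Or.inl h)
    have h2 : g x = 0 := image_eq_zero_of_notMem_tsupport fun h => hx (Or.inr h)
    simp only [h1, h2, ← Prod.zero_eq_mk, sub_self]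

theorem exists_integral_mul_le [NeZero d] {p q : ℝ} (hpq : p.HolderConjugate q) :
    ∃ C, 0 < C ∧ ∀ (w g : EuclideanSpace ℝ (Fin d) → ℝ)
      (e : Fin d → Fin d → EuclideanSpace ℝ (Fin d) → ℝ), IsTestFun w → IsTestFun g →
      (∀ a b, IsTestFun (e a b)) → ∀ j k : Fin d,
      (∀ i x, partialDeriv i w x =
        partialDeriv i (e j k) x + partialDeriv j (e i k) x - partialDeriv k (e i j) x) →
      ∫ x, w x * g x ≤ C * ((∑ a, ∑ b, ∫ x, |e a b x| ^ p) + ∫ x, |g x| ^ q) := by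
  obtain ⟨C, hC, hbell⟩ := exists_isBellman hpq
  have hd : (1 : ℝ) ≤ d := by exact_mod_cast NeZero.one_le
  refine ⟨3 * d * (C * d ^ 2) + 1, by positivity, fun w g e hw hg he j k hwe => ?_⟩
  set E := ∑ a, ∑ b, ∫ x, |e a b x| ^ p with hE
  set G := ∫ x, |g x| ^ q with hG
  have hE0 : 0 ≤ E := Finset.sum_nonneg fun a _ => Finset.sum_nonneg fun b _ =>
    integral_nonneg fun x => by positivity
  have hG0 : 0 ≤ G := integral_nonneg fun x => by positivity
  set M := ∑ a, ∑ b, volume.real (tsupport (e a b) ∪ tsupport g) with hM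
  have key : ∀ δ : ℝ, 0 < δ → δ ≤ 1 →
      ∫ x, w x * g x ≤ 3 * d * (C * (E + d ^ 2 * G + δ * M)) := by
    intro δ hδ hδ1
    obtain ⟨B, hB, hle⟩ := hbell δ hδ hδ1
    refine (integral_mul_le_of_isBellman hB hw hg he j k hwe).trans ?_
    gcongr
    calc ∑ a, ∑ b, ∫ x, (B (e a b x, g x) - B 0)
        ≤ ∑ a, ∑ b, C * ((∫ x, |e a b x| ^ p) + G
            + δ * volume.real (tsupport (e a b) ∪ tsupport g)) := by
          gcongr with a _ b _
          exact integral_bellman_le hB.contDiff.continuous hpq.pos hpq.symm.pos hle (he a b) hg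
      _ = C * (E + d ^ 2 * G + δ * M) := by
          simp only [← Finset.mul_sum, Finset.sum_add_distrib, Finset.sum_const, Finset.card_univ,
            Fintype.card_fin, nsmul_eq_mul]
          ring
  have hlim : Tendsto (fun δ : ℝ => 3 * d * (C * (E + d ^ 2 * G + δ * M))) (𝓝[>] 0)
      (𝓝 (3 * d * (C * (E + d ^ 2 * G + 0 * M)))) := by
    refine Tendsto.mono_left (Continuous.tendsto ?_ 0) nhdsWithin_le_nhds
    fun_prop
  have h1 : ∫ x, w x * g x ≤ 3 * d * (C * (E + d ^ 2 * G + 0 * M)) := by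
    refine ge_of_tendsto hlim ?_
    filter_upwards [Ioc_mem_nhdsGT (zero_lt_one (α := ℝ))] with δ hδ using key δ hδ.1 hδ.2
  have h2 : E ≤ d ^ 2 * E := le_mul_of_one_le_left hE0 (one_le_pow₀ hd)
  calc _ ≤ _ := h1
    _ ≤ 3 * d * (C * (d ^ 2 * E + d ^ 2 * G + 0 * M)) := by gcongr
    _ = 3 * d * (C * d ^ 2) * (E + G) := by ring
    _ ≤ _ := by gcongr; linarith

lemma IsTestFun.const_smul {f : EuclideanSpace ℝ (Fin d) → W} (hf : IsTestFun f) (c : ℝ) :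
    IsTestFun fun x => c • f x :=
  ⟨contDiff_const.smul hf.smooth, hf.compact.smul_left (f := fun _ => c)⟩

lemma partialDeriv_const_mul {f : EuclideanSpace ℝ (Fin d) → ℝ} (hf : IsTestFun f) (c : ℝ)
    (i : Fin d) (x : EuclideanSpace ℝ (Fin d)) :
    partialDeriv i (fun x => c * f x) x = c * partialDeriv i f x := by
  simp [partialDeriv, fderiv_const_mul (hf.hasFDerivAt x).differentiableAt]

/-- A smooth approximation of `|w| ^ (p - 2) * w`. -/
noncomputable def regPow (p ε w : ℝ) : ℝ := (w ^ 2 + ε) ^ ((p - 2) / 2) * w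

lemma IsTestFun.regPow {w : EuclideanSpace ℝ (Fin d) → ℝ} (hw : IsTestFun w) (p : ℝ) {ε : ℝ}
    (hε : 0 < ε) : IsTestFun fun x => regPow p ε (w x) :=
  ⟨(((hw.smooth.pow 2).add contDiff_const).rpow_const_of_ne fun x => by positivity).mul hw.smooth,
    hw.compact.mul_left⟩

lemma abs_regPow_le {p ε w M : ℝ} (hp : 1 < p) (hε : 0 < ε) (hε1 : ε ≤ 1) (hw : |w| ≤ M) :
    |regPow p ε w| ≤ (M ^ 2 + 1) ^ ((p - 1) / 2) := by
  have h1 : |w| ≤ (w ^ 2 + ε) ^ (1 / 2 : ℝ) := by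
    rw [← sqrt_eq_rpow]
    exact abs_le_sqrt (by linarith)
  have h2 : w ^ 2 ≤ M ^ 2 := by rw [← sq_abs]; gcongr
  have hp' : 0 ≤ (p - 1) / 2 := by linarith
  calc |regPow p ε w| = (w ^ 2 + ε) ^ ((p - 2) / 2) * |w| := by
        rw [regPow, abs_mul, abs_of_nonneg (by positivity)]
    _ ≤ (w ^ 2 + ε) ^ ((p - 2) / 2) * (w ^ 2 + ε) ^ (1 / 2 : ℝ) := by gcongr
    _ = (w ^ 2 + ε) ^ ((p - 1) / 2) := by
        rw [← rpow_add (by positivity)]; congr 1; ring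
    _ ≤ _ := by gcongr

lemma tendsto_regPow {p : ℝ} {w : ℝ} (hw : w ≠ 0) :
    Tendsto (fun ε => regPow p ε w) (𝓝[>] 0) (𝓝 (|w| ^ (p - 2) * w)) := by
  have h1 : (w ^ 2 + 0) ^ ((p - 2) / 2) = |w| ^ (p - 2) := by
    rw [add_zero, ← sq_abs, ← rpow_natCast_mul (abs_nonneg w)]
    congr 1; push_cast; ring
  rw [← h1]
  have h2 : ContinuousAt (fun ε => regPow p ε w) 0 := by
    unfold regPow
    refine ContinuousAt.mul ?_ continuousAt_const
    exact (continuousAt_const.add continuousAt_id).rpow_const (Or.inl (by simpa using hw))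
  exact h2.tendsto.mono_left nhdsWithin_le_nhds

lemma tendsto_mul_regPow {p : ℝ} (hp : 1 < p) (w : ℝ) :
    Tendsto (fun ε => w * regPow p ε w) (𝓝[>] 0) (𝓝 (|w| ^ p)) := by
  rcases eq_or_ne w 0 with rfl | hw
  · simp [zero_rpow (by linarith : p ≠ 0)]
  · have h1 : w * (|w| ^ (p - 2) * w) = |w| ^ p := by
      have h0 : 0 < |w| := abs_pos.2 hw
      rw [rpow_sub h0, rpow_two, sq_abs]
      field_simp
    rw [← h1]
    exact (tendsto_regPow hw).const_mul w

lemma tendsto_abs_regPow_rpow {p q : ℝ} (hpq : p.HolderConjugate q) (w : ℝ) :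
    Tendsto (fun ε => |regPow p ε w| ^ q) (𝓝[>] 0) (𝓝 (|w| ^ p)) := by
  have hq := hpq.symm.pos
  rcases eq_or_ne w 0 with rfl | hw
  · simp [regPow, zero_rpow hpq.ne_zero, zero_rpow hq.ne']
  · have h1 : |(|w| ^ (p - 2) * w)| ^ q = |w| ^ p := by
      have h0 : 0 < |w| := abs_pos.2 hw
      rw [abs_mul, abs_of_nonneg (by positivity), ← rpow_add_one h0.ne', ← rpow_mul h0.le]
      congr 1
      have := hpq.mul_eq_add
      linarith
    rw [← h1]
    exact (tendsto_regPow hw).abs.rpow_const (Or.inr hq.le)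

theorem exists_integral_rpow_le [NeZero d] {p : ℝ} (hp : 1 < p) :
    ∃ C, 0 ≤ C ∧ ∀ (w : EuclideanSpace ℝ (Fin d) → ℝ)
      (e : Fin d → Fin d → EuclideanSpace ℝ (Fin d) → ℝ), IsTestFun w →
      (∀ a b, IsTestFun (e a b)) → ∀ j k : Fin d,
      (∀ i x, partialDeriv i w x =
        partialDeriv i (e j k) x + partialDeriv j (e i k) x - partialDeriv k (e i j) x) →
      ∫ x, |w x| ^ p ≤ C * ∑ a, ∑ b, ∫ x, |e a b x| ^ p := by
  have hpq := Real.HolderConjugate.conjExponent hp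
  set q := p.conjExponent
  obtain ⟨K, hK, hKle⟩ := exists_integral_mul_le (d := d) hpq
  refine ⟨(2 * K) ^ p, by positivity, fun w e hw he j k hwe => ?_⟩
  have key : ∀ ε : ℝ, 0 < ε → 2 * K * ∫ x, w x * regPow p ε (w x) ≤
      K * ((2 * K) ^ p * (∑ a, ∑ b, ∫ x, |e a b x| ^ p) + ∫ x, |regPow p ε (w x)| ^ q) := by
    intro ε hε
    have h1 := hKle (fun x => 2 * K * w x) (fun x => regPow p ε (w x))
      (fun a b x => 2 * K * e a b x) (hw.const_smul _) (hw.regPow p hε)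
      (fun a b => (he a b).const_smul _) j k fun i x => by
        simp only [partialDeriv_const_mul hw, partialDeriv_const_mul (he _ _), hwe]
        ring
    have h2 : ∀ a b x, |2 * K * e a b x| ^ p = (2 * K) ^ p * |e a b x| ^ p := fun a b x => by
      rw [abs_mul, abs_of_pos (by positivity), mul_rpow (by positivity) (abs_nonneg _)]
    simpa only [h2, integral_const_mul, ← Finset.mul_sum, mul_assoc (2 * K)] using h1
  set I := ∫ x, |w x| ^ p
  set E := ∑ a, ∑ b, ∫ x, |e a b x| ^ p
  obtain ⟨M, hM0, hM⟩ := hw.exists_bound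
  simp only [norm_eq_abs] at hM
  set R := (M ^ 2 + 1) ^ ((p - 1) / 2)
  have hR : 0 ≤ R := by positivity
  have hTm : MeasurableSet (tsupport w) := (isClosed_tsupport w).measurableSet
  have hbd : ∀ c : ℝ, Integrable ((tsupport w).indicator fun _ => c) := fun c =>
    (integrable_indicator_iff hTm).2 (integrableOn_const hw.compact.isCompact.measure_lt_top.ne)
  have hε : ∀ᶠ ε : ℝ in 𝓝[>] 0, 0 < ε ∧ ε ≤ 1 := Ioc_mem_nhdsGT (zero_lt_one (α := ℝ))
  have l1 : Tendsto (fun ε => ∫ x, w x * regPow p ε (w x)) (𝓝[>] 0) (𝓝 I) := by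
    refine tendsto_integral_filter_of_dominated_convergence _ ?_ ?_ (hbd (M * R)) ?_
    · filter_upwards [hε] with ε hε
      exact (hw.continuous.mul (hw.regPow p hε.1).continuous).aestronglyMeasurable
    · filter_upwards [hε] with ε hε
      refine ae_of_all _ fun x => ?_
      by_cases hx : x ∈ tsupport w
      · rw [Set.indicator_of_mem hx, norm_mul]
        exact mul_le_mul (hM x) (abs_regPow_le hp hε.1 hε.2 (hM x)) (norm_nonneg _) hM0
      · simp [Set.indicator_of_notMem hx, image_eq_zero_of_notMem_tsupport hx]
    · exact ae_of_all _ fun x => tendsto_mul_regPow hp (w x)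
  have l2 : Tendsto (fun ε => ∫ x, |regPow p ε (w x)| ^ q) (𝓝[>] 0) (𝓝 I) := by
    have hq := hpq.symm.pos
    refine tendsto_integral_filter_of_dominated_convergence _ ?_ ?_ (hbd (R ^ q)) ?_
    · filter_upwards [hε] with ε hε
      exact ((hw.regPow p hε.1).continuous.abs.rpow_const
        fun _ => Or.inr hq.le).aestronglyMeasurable
    · filter_upwards [hε] with ε hε
      refine ae_of_all _ fun x => ?_
      by_cases hx : x ∈ tsupport w
      · rw [Set.indicator_of_mem hx, norm_eq_abs, abs_of_nonneg (by positivity)]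
        exact rpow_le_rpow (abs_nonneg _) (abs_regPow_le hp hε.1 hε.2 (hM x)) hq.le
      · simp [Set.indicator_of_notMem hx, image_eq_zero_of_notMem_tsupport hx, regPow,
          zero_rpow hq.ne']
    · exact ae_of_all _ fun x => tendsto_abs_regPow_rpow hpq (w x)
  have h3 : 2 * K * I ≤ K * ((2 * K) ^ p * E + I) := by
    refine le_of_tendsto_of_tendsto (l1.const_mul (2 * K)) ((l2.const_add _).const_mul K) ?_
    filter_upwards [hε] with ε hε using key ε hε.1
  have h4 : K * I ≤ K * ((2 * K) ^ p * E) := by linarith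
  exact le_of_mul_le_mul_left h4 hK

lemma IsTestFun.add {f g : EuclideanSpace ℝ (Fin d) → W} (hf : IsTestFun f) (hg : IsTestFun g) :
    IsTestFun fun x => f x + g x :=
  ⟨hf.smooth.add hg.smooth, hf.compact.add hg.compact⟩

lemma partialDeriv_add {f g : EuclideanSpace ℝ (Fin d) → W} (hf : IsTestFun f) (hg : IsTestFun g)
    (i : Fin d) (x : EuclideanSpace ℝ (Fin d)) :
    partialDeriv i (fun x => f x + g x) x = partialDeriv i f x + partialDeriv i g x := by
  simp [partialDeriv, fderiv_fun_add (hf.hasFDerivAt x).differentiableAt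
    (hg.hasFDerivAt x).differentiableAt]

lemma partialDeriv_comm {f : EuclideanSpace ℝ (Fin d) → W} (hf : IsTestFun f) (i j : Fin d)
    (x : EuclideanSpace ℝ (Fin d)) :
    partialDeriv i (partialDeriv j f) x = partialDeriv j (partialDeriv i f) x := by
  have hsymm : IsSymmSndFDerivAt ℝ f x :=
    hf.smooth.contDiffAt.isSymmSndFDerivAt (by
      rw [minSmoothness_of_isRCLikeNormedField]
      exact WithTop.coe_le_coe.2 (le_top : (2 : ℕ∞) ≤ ⊤))
  have h : ∀ a b : Fin d, partialDeriv a (partialDeriv b f) x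
      = fderiv ℝ (fderiv ℝ f) x (EuclideanSpace.single a 1) (EuclideanSpace.single b 1) := by
    intro a b
    have := ((hf.fderiv.hasFDerivAt x).clm_apply
      (hasFDerivAt_const (EuclideanSpace.single b (1 : ℝ)) x)).fderiv
    simp only [partialDeriv]
    erw [this]
    simp
  rw [h, h]
  exact hsymm _ _

theorem exists_integral_partialDeriv_rpow_le [NeZero d] {p : ℝ} (hp : 1 < p) :
    ∃ C, 0 ≤ C ∧ ∀ u : Fin d → EuclideanSpace ℝ (Fin d) → ℝ, (∀ k, IsTestFun (u k)) →
      ∀ j k : Fin d, ∫ x, |partialDeriv j (u k) x| ^ p ≤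
        C * ∑ a, ∑ b, ∫ x, |(partialDeriv a (u b) x + partialDeriv b (u a) x) / 2| ^ p := by
  obtain ⟨C, hC, h⟩ := exists_integral_rpow_le (d := d) hp
  refine ⟨C, hC, fun u hu j k => ?_⟩
  have hs : ∀ a b, IsTestFun fun x => partialDeriv a (u b) x + partialDeriv b (u a) x :=
    fun a b => ((hu b).partialDeriv a).add ((hu a).partialDeriv b)
  have key := h (partialDeriv j (u k))
    (fun a b x => 2⁻¹ * (partialDeriv a (u b) x + partialDeriv b (u a) x))
    ((hu k).partialDeriv j) (fun a b => (hs a b).const_smul 2⁻¹) j k fun i x => by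
      simp only [partialDeriv_const_mul (hs _ _),
        partialDeriv_add ((hu _).partialDeriv _) ((hu _).partialDeriv _)]
      rw [partialDeriv_comm (hu k) j i, partialDeriv_comm (hu j) k i, partialDeriv_comm (hu i) k j]
      ring
  simpa only [div_eq_inv_mul] using key

theorem exists_integral_sqrt_rpow_le [NeZero d] {p : ℝ} (hp : 1 < p) :
    ∃ C, 0 ≤ C ∧ ∀ u : Fin d → EuclideanSpace ℝ (Fin d) → ℝ, (∀ k, IsTestFun (u k)) →
      ∫ x, √(∑ i, ∑ j, partialDeriv i (u j) x ^ 2) ^ p ≤ C * ∫ x,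
        √(∑ i, ∑ j, ((partialDeriv i (u j) x + partialDeriv j (u i) x) / 2) ^ 2) ^ p := by
  obtain ⟨C, hC, h⟩ := exists_integral_partialDeriv_rpow_le (d := d) hp
  have hp0 : 0 < p := by linarith
  set m : ℝ := ((Finset.univ : Finset (Fin d × Fin d)).card : ℝ) with hm
  refine ⟨m ^ (p - 1) * (m * (C * m)), by positivity, fun u hu => ?_⟩
  have int_of : ∀ f : EuclideanSpace ℝ (Fin d) → ℝ, Continuous f → HasCompactSupport f →
      Integrable fun x => |f x| ^ p := fun f hf hfc =>
    (hf.abs.rpow_const fun _ => Or.inr hp0.le).integrable_of_hasCompactSupport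
      (hfc.comp_left (g := fun y : ℝ => |y| ^ p) (by simp [zero_rpow hp0.ne']))
  have hs : ∀ a b, IsTestFun fun x => (partialDeriv a (u b) x + partialDeriv b (u a) x) / 2 :=
    fun a b => by
      simpa only [div_eq_inv_mul, smul_eq_mul] using
        (((hu b).partialDeriv a).add ((hu a).partialDeriv b)).const_smul 2⁻¹
  set D : EuclideanSpace ℝ (Fin d) → ℝ := fun x =>
    √(∑ i, ∑ j, ((partialDeriv i (u j) x + partialDeriv j (u i) x) / 2) ^ 2) with hD
  have hDc : Continuous D :=
    continuous_sqrt.comp (continuous_finsetSum _ fun a _ => continuous_finsetSum _ fun b _ =>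
      (hs a b).continuous.pow 2)
  have hDs : HasCompactSupport D := by
    refine HasCompactSupport.intro
      (K := ⋃ a, ⋃ b, tsupport fun x => (partialDeriv a (u b) x + partialDeriv b (u a) x) / 2)
      (isCompact_iUnion fun a => isCompact_iUnion fun b => (hs a b).compact.isCompact)
      fun x hx => ?_
    simp only [Set.mem_iUnion, not_exists] at hx
    have h0 : ∀ a b, (partialDeriv a (u b) x + partialDeriv b (u a) x) / 2 = 0 := fun a b =>
      image_eq_zero_of_notMem_tsupport
        (f := fun x => (partialDeriv a (u b) x + partialDeriv b (u a) x) / 2) (hx a b)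
    simp [hD, h0]
  have hDi : Integrable fun x => D x ^ p := by
    simpa only [abs_of_nonneg (sqrt_nonneg _), hD] using int_of D hDc hDs
  have h1 : ∀ x, √(∑ i, ∑ j, partialDeriv i (u j) x ^ 2) ^ p
      ≤ m ^ (p - 1) * ∑ k : Fin d × Fin d, |partialDeriv k.1 (u k.2) x| ^ p := by
    intro x
    refine le_trans ?_ (rpow_sum_le_const_mul_sum_rpow Finset.univ
      (fun k : Fin d × Fin d => partialDeriv k.1 (u k.2) x) hp.le)
    rw [← Fintype.sum_prod_type' (f := fun i j => partialDeriv i (u j) x ^ 2)]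
    refine rpow_le_rpow (sqrt_nonneg _) (sqrt_le_iff.2 ⟨by positivity, ?_⟩) hp0.le
    simpa only [sq_abs] using Finset.sum_sq_le_sq_sum_of_nonneg (s := Finset.univ)
      (f := fun k : Fin d × Fin d => |partialDeriv k.1 (u k.2) x|) fun _ _ => abs_nonneg _
  have h2 : ∀ a b, ∫ x, |(partialDeriv a (u b) x + partialDeriv b (u a) x) / 2| ^ p
      ≤ ∫ x, D x ^ p := by
    intro a b
    refine integral_mono (int_of _ (hs a b).continuous (hs a b).compact) hDi fun x => ?_
    refine rpow_le_rpow (abs_nonneg _) (abs_le_sqrt ?_) hp0.le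
    rw [← Fintype.sum_prod_type'
      (f := fun i j => ((partialDeriv i (u j) x + partialDeriv j (u i) x) / 2) ^ 2)]
    exact Finset.single_le_sum
      (f := fun k : Fin d × Fin d =>
        ((partialDeriv k.1 (u k.2) x + partialDeriv k.2 (u k.1) x) / 2) ^ 2)
      (fun _ _ => sq_nonneg _) (Finset.mem_univ (a, b))
  have h3 : ∑ a, ∑ b, ∫ x, |(partialDeriv a (u b) x + partialDeriv b (u a) x) / 2| ^ p
      ≤ m * ∫ x, D x ^ p := by
    rw [← Fintype.sum_prod_type' (f := fun a b =>
      ∫ x, |(partialDeriv a (u b) x + partialDeriv b (u a) x) / 2| ^ p)]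
    refine (Finset.sum_le_card_nsmul _ _ _ fun k _ => h2 k.1 k.2).trans_eq ?_
    rw [nsmul_eq_mul]
  have hi : ∀ k : Fin d × Fin d, Integrable fun x => |partialDeriv k.1 (u k.2) x| ^ p := fun k =>
    int_of _ ((hu k.2).partialDeriv k.1).continuous ((hu k.2).partialDeriv k.1).compact
  calc ∫ x, √(∑ i, ∑ j, partialDeriv i (u j) x ^ 2) ^ p
      ≤ ∫ x, m ^ (p - 1) * ∑ k : Fin d × Fin d, |partialDeriv k.1 (u k.2) x| ^ p :=
        integral_mono_of_nonneg (ae_of_all _ fun x => by positivity)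
          ((integrable_finsetSum _ fun k _ => hi k).const_mul _) (ae_of_all _ h1)
    _ = m ^ (p - 1) * ∑ k : Fin d × Fin d, ∫ x, |partialDeriv k.1 (u k.2) x| ^ p := by
        rw [integral_const_mul, integral_finsetSum _ fun k _ => hi k]
    _ ≤ m ^ (p - 1) * ∑ k : Fin d × Fin d, C * (m * ∫ x, D x ^ p) := by
        gcongr with k _
        exact (h u hu k.1 k.2).trans (by gcongr)
    _ = _ := by
        rw [Finset.sum_const, nsmul_eq_mul, ← hm]
        ring

lemma integral_sqrt_symm_rpow_le {p : ℝ} (hp : 0 < p)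
    {u : Fin d → EuclideanSpace ℝ (Fin d) → ℝ} (hu : ∀ k, IsTestFun (u k)) :
    ∫ x, √(∑ i, ∑ j, ((partialDeriv i (u j) x + partialDeriv j (u i) x) / 2) ^ 2) ^ p
      ≤ ∫ x, √(∑ i, ∑ j, partialDeriv i (u j) x ^ 2) ^ p := by
  have hc : Continuous fun x => √(∑ i, ∑ j, partialDeriv i (u j) x ^ 2) ^ p :=
    (continuous_sqrt.comp (continuous_finsetSum _ fun i _ => continuous_finsetSum _ fun j _ =>
      ((hu j).partialDeriv i).continuous.pow 2)).rpow_const fun _ => Or.inr hp.le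
  have hs : HasCompactSupport fun x => √(∑ i, ∑ j, partialDeriv i (u j) x ^ 2) ^ p := by
    refine HasCompactSupport.intro (K := ⋃ i, ⋃ j, tsupport (partialDeriv i (u j)))
      (isCompact_iUnion fun i => isCompact_iUnion fun j =>
        ((hu j).partialDeriv i).compact.isCompact) fun x hx => ?_
    simp only [Set.mem_iUnion, not_exists] at hx
    have h0 : ∀ i j, partialDeriv i (u j) x = 0 := fun i j =>
      image_eq_zero_of_notMem_tsupport (hx i j)
    simp [h0, zero_rpow hp.ne']
  refine integral_mono_of_nonneg (ae_of_all _ fun x => by positivity)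
    (hc.integrable_of_hasCompactSupport hs) (ae_of_all _ fun x => ?_)
  refine rpow_le_rpow (sqrt_nonneg _) (sqrt_le_sqrt ?_) hp.le
  have h1 : ∑ i, ∑ j, partialDeriv i (u j) x ^ 2
      = ∑ i, ∑ j, (partialDeriv i (u j) x ^ 2 + partialDeriv j (u i) x ^ 2) / 2 := by
    have h2 := Finset.sum_comm (s := Finset.univ) (t := Finset.univ)
      (f := fun i j => partialDeriv j (u i) x ^ 2)
    simp only [← Finset.sum_div, Finset.sum_add_distrib, h2]
    ring
  rw [h1]
  gcongr with i _ j _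
  nlinarith [sq_nonneg (partialDeriv i (u j) x - partialDeriv j (u i) x)]

end Heat

/-- **Norm equivalence for the symmetric gradient** (Lemma 2.1 of the paper, on the dense
subspace `C_c^∞(Ω; ℝ^d)`): on a bounded open set `Ω ⊆ ℝ^d` (`d ≥ 2`), for `1 < p < ∞`, there
are constants `C₁, C₂ > 0` such that for every smooth compactly supported vector field `u`
supported in `Ω`,
`C₁ (‖u‖_{L^p} + ‖∇u‖_{L^p}) ≤ ‖u‖_{L^p} + ‖𝒟(u)‖_{L^p} ≤ C₂ (‖u‖_{L^p} + ‖∇u‖_{L^p})`,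
where `∇u` is the Jacobian matrix `(∂_i u_j)` with Frobenius norm and
`𝒟(u) = (∇u + (∇u)ᵀ)/2`. -/
theorem statement0
    (d : ℕ) (hd : 2 ≤ d) (p : ℝ) (hp1 : 1 < p)
    (Ω : Set (EuclideanSpace ℝ (Fin d))) (hΩopen : IsOpen Ω)
    (hΩbdd : Bornology.IsBounded Ω) :
    ∃ C₁ C₂ : ℝ, 0 < C₁ ∧ 0 < C₂ ∧
      ∀ u : EuclideanSpace ℝ (Fin d) → EuclideanSpace ℝ (Fin d),
        ContDiff ℝ (⊤ : ℕ∞) u → HasCompactSupport u → tsupport u ⊆ Ω →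
        (C₁ * ((∫ x in Ω, ‖u x‖ ^ p) ^ (1 / p)
              + (∫ x in Ω, (Real.sqrt (∑ i, ∑ j,
                  (fderiv ℝ u x (EuclideanSpace.single i 1) j) ^ 2)) ^ p) ^ (1 / p))
          ≤ (∫ x in Ω, ‖u x‖ ^ p) ^ (1 / p)
              + (∫ x in Ω, (Real.sqrt (∑ i, ∑ j,
                  ((fderiv ℝ u x (EuclideanSpace.single i 1) j
                    + fderiv ℝ u x (EuclideanSpace.single j 1) i) / 2) ^ 2)) ^ p) ^ (1 / p))
        ∧ ((∫ x in Ω, ‖u x‖ ^ p) ^ (1 / p)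
              + (∫ x in Ω, (Real.sqrt (∑ i, ∑ j,
                  ((fderiv ℝ u x (EuclideanSpace.single i 1) j
                    + fderiv ℝ u x (EuclideanSpace.single j 1) i) / 2) ^ 2)) ^ p) ^ (1 / p)
          ≤ C₂ * ((∫ x in Ω, ‖u x‖ ^ p) ^ (1 / p)
              + (∫ x in Ω, (Real.sqrt (∑ i, ∑ j,
                  (fderiv ℝ u x (EuclideanSpace.single i 1) j) ^ 2)) ^ p) ^ (1 / p))) := by
  have : NeZero d := ⟨by omega⟩
  have hp0 : 0 < p := by linarith
  obtain ⟨C, hC, hle⟩ := exists_integral_sqrt_rpow_le (d := d) hp1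
  refine ⟨(1 + C ^ (1 / p))⁻¹, 1, by positivity, one_pos, fun u hu huc hsub => ?_⟩
  have hut : IsTestFun u := ⟨hu, huc⟩
  set v : Fin d → EuclideanSpace ℝ (Fin d) → ℝ := fun k x => EuclideanSpace.proj (𝕜 := ℝ) k (u x)
  have hv : ∀ k, IsTestFun (v k) := fun k => hut.clm_comp (EuclideanSpace.proj k)
  have hpd : ∀ i k x, fderiv ℝ u x (EuclideanSpace.single i 1) k = partialDeriv i (v k) x :=
    fun i k x => (congrFun (hut.partialDeriv_clm_comp (EuclideanSpace.proj k) i) x).symm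
  have hzero : ∀ i k x, x ∉ Ω → partialDeriv i (v k) x = 0 := fun i k x hx => by
    rw [← hpd, Function.notMem_support.1 fun h => hx (hsub (support_fderiv_subset ℝ h))]
    simp
  simp only [hpd]
  rw [setIntegral_eq_integral_of_forall_compl_eq_zero (s := Ω)
      (f := fun x => √(∑ i, ∑ j, partialDeriv i (v j) x ^ 2) ^ p) fun x hx => by
        simp [hzero _ _ x hx, Real.zero_rpow hp0.ne'],
    setIntegral_eq_integral_of_forall_compl_eq_zero (s := Ω) (f := fun x =>
      √(∑ i, ∑ j, ((partialDeriv i (v j) x + partialDeriv j (v i) x) / 2) ^ 2) ^ p) fun x hx => by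
        simp [hzero _ _ x hx, Real.zero_rpow hp0.ne']]
  have hI := hle v hv
  have hJ := integral_sqrt_symm_rpow_le hp0 hv
  have hU : 0 ≤ (∫ x in Ω, ‖u x‖ ^ p) ^ (1 / p) :=
    Real.rpow_nonneg (integral_nonneg fun x => by positivity) _
  have hN : 0 ≤ ∫ x, √(∑ i, ∑ j, partialDeriv i (v j) x ^ 2) ^ p :=
    integral_nonneg fun x => by positivity
  have hD : 0 ≤ ∫ x, √(∑ i, ∑ j,
      ((partialDeriv i (v j) x + partialDeriv j (v i) x) / 2) ^ 2) ^ p :=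
    integral_nonneg fun x => by positivity
  generalize (∫ x in Ω, ‖u x‖ ^ p) ^ (1 / p) = U at *
  generalize ∫ x, √(∑ i, ∑ j, partialDeriv i (v j) x ^ 2) ^ p = N at *
  generalize ∫ x, √(∑ i, ∑ j,
    ((partialDeriv i (v j) x + partialDeriv j (v i) x) / 2) ^ 2) ^ p = S at *
  have hr : 0 ≤ 1 / p := by positivity
  have h1 : N ^ (1 / p) ≤ C ^ (1 / p) * S ^ (1 / p) := by
    rw [← Real.mul_rpow hC hD]
    exact Real.rpow_le_rpow hN hI hr
  have h2 : S ^ (1 / p) ≤ N ^ (1 / p) := Real.rpow_le_rpow hD hJ hr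
  have hc : 0 ≤ C ^ (1 / p) := by positivity
  have hS : 0 ≤ S ^ (1 / p) := by positivity
  refine ⟨?_, by linarith⟩
  rw [inv_mul_le_iff₀ (by positivity)]
  nlinarith [mul_nonneg hc hU]
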